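/- Let n be a positive integer and let K be a compact metric space with dim_T K ≥ n. Then for a generic f ∈ C(K,ℝⁿ) one has dim_T ∂f(K) = dim_H ∂f(K) = n − 1, where ∂f(K) denotes the boundary of f(K) in ℝⁿ. Moreover, if h is a gauge function with lim_{r→0+} h(r)/r^{n−1} = 0, then for a generic f ∈ C(K,ℝⁿ) one has ℋ^h(∂f(K)) = 0 and ℋ^{n−1}(∂f(K)) > 0. -/

import Mathlib

open Set Metric Filter Topology TopologicalSpace
open scoped ENNReal NNReal

noncomputable section

universe u

/-- `indBelow n X` means that the small inductive (topological) dimension of `X`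
is at most `n - 1`; in particular `indBelow 0 X` means `X = ∅`. -/
def indBelow : ℕ → ∀ (X : Type u) [TopologicalSpace X], Prop
  | 0, X, _ => IsEmpty X
  | n + 1, X, inst =>
      letI := inst
      ∀ (x : X) (U : Set X), IsOpen U → x ∈ U →
        ∃ V : Set X, IsOpen V ∧ x ∈ V ∧ V ⊆ U ∧ indBelow n ↥(frontier V)

/-- The small inductive (topological) dimension, with values in `EReal`:
`-1` for the empty space and `⊤` if there is no finite bound. -/
def indDim (X : Type u) [TopologicalSpace X] : EReal :=
  sInf {d : EReal | ∃ n : ℕ, indBelow n X ∧ d = (n : EReal) - 1}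

variable {X : Type u} [MetricSpace X]

/-- Topological dimension of a subset of a metric space. -/
def tdim (A : Set X) : EReal := indDim ↥A

open Classical in
/-- Hausdorff dimension of a subset of a metric space,
with the convention `dim ∅ = -1`. -/
def hdim (A : Set X) : EReal := if A = ∅ then -1 else ((dimH A : ℝ≥0∞) : EReal)

/-- A `δ`-packing of `A`: a countable family of pairwise disjoint closed balls
with centers in `A` and radii at most `δ`. -/
def IsPacking (A : Set X) (δ : ℝ≥0) (s : Set (X × ℝ≥0)) : Prop :=
  s.Countable ∧ (∀ p ∈ s, p.1 ∈ A ∧ p.2 ≤ δ) ∧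
    s.Pairwise fun p q => Disjoint (closedBall p.1 (p.2 : ℝ)) (closedBall q.1 (q.2 : ℝ))

/-- The packing pre-measure `P^h_δ(A)`. -/
def packPre (h : ℝ≥0 → ℝ≥0) (A : Set X) (δ : ℝ≥0) : ℝ≥0∞ :=
  ⨆ (s : Set (X × ℝ≥0)) (_ : IsPacking A δ s), ∑' p : s, ((h p.1.2 : ℝ≥0) : ℝ≥0∞)

/-- The packing pre-measure (packing number) `P^h₀(A) = lim_{δ → 0+} P^h_δ(A)`. -/
def packPre0 (h : ℝ≥0 → ℝ≥0) (A : Set X) : ℝ≥0∞ :=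
  ⨅ (δ : ℝ≥0) (_ : 0 < δ), packPre h A δ

/-- The `h`-packing measure `𝒫^h(A)`. -/
def packMeasure (h : ℝ≥0 → ℝ≥0) (A : Set X) : ℝ≥0∞ :=
  ⨅ (c : ℕ → Set X) (_ : A = ⋃ i, c i), ∑' i, packPre0 h (c i)

open Classical in
/-- The packing dimension, with the convention `dim ∅ = -1`. -/
def pdim (A : Set X) : EReal :=
  if A = ∅ then -1
  else max 0 (⨆ (s : ℝ≥0) (_ : packMeasure (fun r => r ^ (s : ℝ)) A = ∞), ((s : ℝ) : EReal))

/-- The restriction of the packing measure `𝒫^h` to `A` is σ-finite. -/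
def PackSigmaFiniteOn (h : ℝ≥0 → ℝ≥0) (A : Set X) : Prop :=
  ∃ c : ℕ → Set X, A ⊆ ⋃ i, c i ∧ ∀ i, packMeasure h (A ∩ c i) < ∞

/-- The generalized Hausdorff measure `ℋ^h(A)` associated to a gauge function `h`. -/
def hMeasure (h : ℝ≥0 → ℝ≥0) (A : Set X) : ℝ≥0∞ :=
  ⨆ (δ : ℝ≥0) (_ : 0 < δ),
    ⨅ (c : ℕ → Set X) (_ : A ⊆ ⋃ i, c i) (_ : ∀ i, EMetric.diam (c i) ≤ (δ : ℝ≥0∞)),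
      ∑' i, ((h (EMetric.diam (c i)).toNNReal : ℝ≥0) : ℝ≥0∞)

/-- `F` is an `F_σ` subset of the subspace `A`. -/
def IsFSigmaIn (F A : Set X) : Prop :=
  ∃ C : ℕ → Set X, (∀ i, IsClosed (C i)) ∧ F = ⋃ i, C i ∩ A

/-- `d^n_*(A) = inf {dim_*(A ∖ F) : F ⊆ A is F_σ in A and dim_T F ≤ n - 1}`. -/
def dStar (dim : Set X → EReal) (n : ℕ) (A : Set X) : EReal :=
  sInf {d : EReal |
    ∃ F : Set X, IsFSigmaIn F A ∧ tdim F ≤ (n : EReal) - 1 ∧ d = dim (A \ F)}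

end

/-- The `j`-th vertex of the monotone lattice path which starts at `v` and increases the
coordinates one after the other, in the order given by `π`. -/
def latticePath {n : ℕ} (v : Fin n → ℕ) (π : Equiv.Perm (Fin n)) (j : ℕ) : Fin n → ℕ :=
  fun k => v k + if (π.symm k : ℕ) < j then 1 else 0

/-- The lattice path `latticePath v π` without its first step. -/
def latticePathTail {d : ℕ} (v : Fin (d + 1) → ℕ) (π : Equiv.Perm (Fin (d + 1))) (j : ℕ) :
    Fin (d + 1) → ℕ :=
  fun k => v k + if 1 ≤ (π.symm k : ℕ) ∧ (π.symm k : ℕ) ≤ j then 1 else 0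

lemma latticePath_mul_swap {n : ℕ} (v : Fin n → ℕ) (π : Equiv.Perm (Fin n)) {a b : Fin n}
    (hab : (b : ℕ) = a + 1) {j : ℕ} (hj : j ≠ b) :
    latticePath v (π * Equiv.swap a b) j = latticePath v π j := by
  funext k
  have h1 : (π * Equiv.swap a b).symm k = Equiv.swap a b (π.symm k) := by
    rw [Equiv.symm_apply_eq]; simp
  have h2 : ((Equiv.swap a b (π.symm k) : Fin n) : ℕ) < j ↔ (π.symm k : ℕ) < j := by
    rw [Equiv.swap_apply_def]
    split_ifs with h h'
    · rw [h]; omega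
    · rw [h']; omega
    · rfl
  simp only [latticePath, h1, h2]

lemma latticePath_succ_eq_tail {d : ℕ} (v : Fin (d + 1) → ℕ) (π : Equiv.Perm (Fin (d + 1)))
    (j : ℕ) :
    latticePath v π (j + 1) = latticePathTail (v + Pi.single (π 0) 1) π j := by
  funext k
  by_cases hk : k = π 0
  · subst hk
    simp [latticePath, latticePathTail]
  · have : (π.symm k : ℕ) ≠ 0 := by
      intro h
      apply hk
      rw [← Equiv.symm_apply_eq]
      exact Fin.ext h
    simp only [latticePath, latticePathTail, Pi.add_apply, Pi.single_eq_of_ne hk, add_zero]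
    congr 2
    apply propext
    omega

lemma latticePath_mul_finRotate {d : ℕ} (v : Fin (d + 1) → ℕ) (π : Equiv.Perm (Fin (d + 1)))
    {j : ℕ} (hj : j ≤ d) :
    latticePath v (π * finRotate (d + 1)) j = latticePathTail v π j := by
  funext k
  obtain ⟨i, rfl⟩ : ∃ i, (π * finRotate (d + 1)) i = k := ⟨_, Equiv.apply_symm_apply _ _⟩
  simp only [latticePath, latticePathTail, Equiv.symm_apply_apply]
  congr 2
  apply propext
  simp only [Equiv.Perm.coe_mul, Function.comp_apply, Equiv.symm_apply_apply]
  rw [coe_finRotate]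
  have := i.isLt
  split_ifs with h
  · have : (i : ℕ) = d := by rw [h]; rfl
    omega
  · omega

/-- The mod 2 count attached to a lattice path: the cup product of the coboundaries of
the functions `F i`. -/
def cupCount {n : ℕ} (F : Fin n → (Fin n → ℕ) → ZMod 2) (p : ℕ → Fin n → ℕ) : ZMod 2 :=
  ∏ i : Fin n, (F i (p (i + 1)) + F i (p i))

/-- The cup product of `F 0` with the coboundaries of the other functions. -/
def cupTail {d : ℕ} (F : Fin (d + 1) → (Fin (d + 1) → ℕ) → ZMod 2)
    (p : ℕ → Fin (d + 1) → ℕ) : ZMod 2 :=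
  F 0 (p 0) * ∏ i : Fin d, (F i.succ (p (i + 1)) + F i.succ (p i))

lemma sum_perm_shift {d : ℕ} (F : Fin (d + 1) → (Fin (d + 1) → ℕ) → ZMod 2)
    (v : Fin (d + 1) → ℕ) :
    ∑ π : Equiv.Perm (Fin (d + 1)), F 0 (latticePath v π 0) *
        ∏ i : Fin d, (F i.succ (latticePath v π (i + 2)) + F i.succ (latticePath v π (i + 1))) =
      ∑ π : Equiv.Perm (Fin (d + 1)), cupTail F (latticePath v π) := by
  let E : Equiv.Perm (Fin (d + 1)) → Fin d → ZMod 2 := fun π i =>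
    F i.succ (latticePath v π (i + 1)) + F i.succ (latticePath v π i)
  let D : Equiv.Perm (Fin (d + 1)) → Fin d → ZMod 2 := fun π i =>
    F i.succ (latticePath v π (i + 2)) + F i.succ (latticePath v π (i + 1))
  let H : ℕ → ZMod 2 := fun m => ∑ π : Equiv.Perm (Fin (d + 1)), F 0 (latticePath v π 0) *
    ∏ i : Fin d, if (i : ℕ) < m then E π i else D π i
  have key : ∀ m, m ≤ d → H m = H 0 := by
    intro m
    induction m with
    | zero => intro; rfl
    | succ m ih =>
      intro hm
      rw [← ih (by omega), ← sub_eq_zero]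
      simp only [H]
      rw [← Finset.sum_sub_distrib]
      let m' : Fin d := ⟨m, by omega⟩
      let a : Fin (d + 1) := m'.castSucc
      let b : Fin (d + 1) := m'.succ
      let G : Equiv.Perm (Fin (d + 1)) → ZMod 2 := fun π => F 0 (latticePath v π 0) *
        ((F m'.succ (latticePath v π (m + 2)) + F m'.succ (latticePath v π m)) *
        ∏ i ∈ Finset.univ.erase m', if (i : ℕ) < m then E π i else D π i)
      have hG : ∀ π, F 0 (latticePath v π 0) *
          (∏ i : Fin d, if (i : ℕ) < m + 1 then E π i else D π i) -
          F 0 (latticePath v π 0) * (∏ i : Fin d, if (i : ℕ) < m then E π i else D π i) =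
          G π := by
        intro π
        rw [← Finset.mul_prod_erase _ _ (Finset.mem_univ m'),
          ← Finset.mul_prod_erase Finset.univ (fun i : Fin d => if (i : ℕ) < m then E π i else D π i)
            (Finset.mem_univ m')]
        have h1 : ∏ i ∈ Finset.univ.erase m', (if (i : ℕ) < m + 1 then E π i else D π i) =
            ∏ i ∈ Finset.univ.erase m', (if (i : ℕ) < m then E π i else D π i) := by
          refine Finset.prod_congr rfl fun i hi => ?_
          have : (i : ℕ) ≠ m := fun h => (Finset.ne_of_mem_erase hi) (Fin.ext h)
          congr 1
          apply propext; omega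
        rw [h1]
        simp only [G, m', E, D, lt_add_iff_pos_right, zero_lt_one, if_true, lt_irrefl, if_false,
          CharTwo.sub_eq_add]
        have h2 : (2 : ZMod 2) = 0 := rfl
        linear_combination (F 0 (latticePath v π 0) * F m'.succ (latticePath v π (m + 1)) *
          ∏ i ∈ Finset.univ.erase m', (if (i : ℕ) < m then E π i else D π i)) * h2
      rw [Finset.sum_congr rfl fun π _ => hG π]
      have hab : (b : ℕ) = a + 1 := by simp [a, b]
      have hb : (b : ℕ) = m + 1 := by simp [b, m']
      refine Finset.sum_involution (fun π _ => π * Equiv.swap a b) ?_ ?_ ?_ ?_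
      · intro π _
        have : G (π * Equiv.swap a b) = G π := by
          simp only [G, E, D]
          rw [latticePath_mul_swap v π hab (j := 0) (by omega),
            latticePath_mul_swap v π hab (j := m + 2) (by omega),
            latticePath_mul_swap v π hab (j := m) (by omega)]
          congr 2
          refine Finset.prod_congr rfl fun i hi => ?_
          have hi' : (i : ℕ) ≠ m := fun h => (Finset.ne_of_mem_erase hi) (Fin.ext h)
          split_ifs with him
          · rw [latticePath_mul_swap v π hab (by omega), latticePath_mul_swap v π hab (by omega)]
          · rw [latticePath_mul_swap v π hab (by omega), latticePath_mul_swap v π hab (by omega)]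
        change G π + G (π * Equiv.swap a b) = 0
        rw [this, CharTwo.add_self_eq_zero]
      · intro π _ _ h
        have h1 : Equiv.swap a b = 1 := by simpa using h
        have h2 : Equiv.swap a b a = a := by rw [h1]; rfl
        rw [Equiv.swap_apply_left] at h2
        omega
      · intro π _
        exact Finset.mem_univ _
      · intro π _
        simp [mul_assoc]
  have h0 := key d le_rfl
  simp only [H, E, D, Fin.is_lt, if_true, not_lt_zero, if_false] at h0
  rw [← h0]
  rfl

lemma sum_grid_telescope {d N : ℕ} (k : Fin (d + 1)) (g : (Fin (d + 1) → ℕ) → ZMod 2) :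
    ∑ v : Fin (d + 1) → Fin N, (g ((fun i => (v i : ℕ)) + Pi.single k 1) + g fun i => (v i : ℕ)) =
      ∑ w : Fin d → Fin N, (g (k.insertNth N fun i => (w i : ℕ)) +
        g (k.insertNth 0 fun i => (w i : ℕ))) := by
  rw [← (Fin.insertNthEquiv (fun _ => Fin N) k).sum_comp, Fintype.sum_prod_type_right]
  refine Finset.sum_congr rfl fun w _ => ?_
  have h1 : ∀ x : Fin N, (fun i => ((Fin.insertNthEquiv (fun _ => Fin N) k (x, w) i : Fin N) : ℕ)) =
      k.insertNth (x : ℕ) fun i => (w i : ℕ) := by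
    intro x
    rw [Fin.eq_insertNth_iff]
    constructor
    · simp
    · funext j; simp [Fin.removeNth]
  have h2 : ∀ x : ℕ, (k.insertNth x (fun i => (w i : ℕ)) : Fin (d + 1) → ℕ) + Pi.single k 1 =
      k.insertNth (x + 1) fun i => (w i : ℕ) := by
    intro x
    rw [Fin.eq_insertNth_iff]
    constructor
    · simp
    · funext j; simp [Fin.removeNth]
  simp only [h1, h2]
  rw [Fin.sum_univ_eq_sum_range
    (fun x => g (k.insertNth (x + 1) fun i => (w i : ℕ)) + g (k.insertNth x fun i => (w i : ℕ))) N]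
  have := Finset.sum_range_sub (fun x => g (k.insertNth x fun i => (w i : ℕ))) N
  simpa only [CharTwo.sub_eq_add] using this

lemma latticePathTail_decomposeFin {d : ℕ} (x : ℕ) (w : Fin d → ℕ) (τ : Equiv.Perm (Fin d)) (j : ℕ) :
    latticePathTail (Fin.cons x w) (Equiv.Perm.decomposeFin.symm (0, τ)) j =
      Fin.cons x (latticePath w τ j) := by
  have h0 : (Equiv.Perm.decomposeFin.symm (0, τ)).symm 0 = 0 := by
    rw [Equiv.symm_apply_eq]; simp
  have h1 : ∀ i, (Equiv.Perm.decomposeFin.symm (0, τ)).symm (Fin.succ i) = (τ.symm i).succ := by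
    intro i
    rw [Equiv.symm_apply_eq]; simp
  funext k
  refine Fin.cases ?_ (fun i => ?_) k
  · simp [latticePathTail, h0]
  · simp only [latticePathTail, latticePath, h1, Fin.cons_succ, Fin.val_succ]
    congr 2
    apply propext; omega

theorem sum_cupCount_eq_one (N : ℕ) : ∀ (n : ℕ) (F : Fin n → (Fin n → ℕ) → ZMod 2),
    (∀ i v, v i = 0 → F i v = 0) → (∀ i v, v i = N → F i v = 1) →
    ∑ v : Fin n → Fin N, ∑ π : Equiv.Perm (Fin n),
      cupCount F (latticePath (fun i => (v i : ℕ)) π) = 1 := by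
  intro n
  induction n with
  | zero => intro F _ _; simp [cupCount]
  | succ d ih =>
    intro F hF0 hF1
    have hsplit : ∀ v : Fin (d + 1) → ℕ, ∑ π : Equiv.Perm (Fin (d + 1)),
        cupCount F (latticePath v π) = ∑ π : Equiv.Perm (Fin (d + 1)),
          (cupTail F (latticePathTail (v + Pi.single (π 0) 1) π) +
            cupTail F (latticePathTail v π)) := by
      intro v
      have h1 : ∀ π : Equiv.Perm (Fin (d + 1)), cupCount F (latticePath v π) =
          cupTail F (latticePathTail (v + Pi.single (π 0) 1) π) + F 0 (latticePath v π 0) *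
            ∏ i : Fin d, (F i.succ (latticePath v π (i + 2)) +
              F i.succ (latticePath v π (i + 1))) := by
        intro π
        rw [cupCount, Fin.prod_univ_succ, add_mul]
        simp only [cupTail, ← latticePath_succ_eq_tail]
        rfl
      rw [Finset.sum_congr rfl fun π _ => h1 π, Finset.sum_add_distrib, sum_perm_shift,
        Finset.sum_add_distrib]
      congr 1
      rw [← Equiv.sum_comp (Equiv.mulRight (finRotate (d + 1)))
        (fun π => cupTail F (latticePath v π))]
      refine Finset.sum_congr rfl fun π _ => ?_
      simp only [Equiv.coe_mulRight, cupTail]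
      rw [latticePath_mul_finRotate v π (Nat.zero_le d)]
      congr 1
      refine Finset.prod_congr rfl fun i _ => ?_
      rw [latticePath_mul_finRotate v π (by omega), latticePath_mul_finRotate v π (by omega)]
    simp only [hsplit]
    rw [Finset.sum_comm]
    simp only [fun π : Equiv.Perm (Fin (d + 1)) => sum_grid_telescope (N := N) (π 0)
      fun v => cupTail F (latticePathTail v π)]
    have htail : ∀ (π : Equiv.Perm (Fin (d + 1))) (v : Fin (d + 1) → ℕ) (j : ℕ),
        latticePathTail v π j (π 0) = v (π 0) := by
      intro π v j; simp [latticePathTail]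
    have hvanish : ∀ (π : Equiv.Perm (Fin (d + 1))) (v : Fin (d + 1) → ℕ) (x : ZMod 2),
        π 0 ≠ 0 → (∀ u : Fin (d + 1) → ℕ, u (π 0) = v (π 0) → F (π 0) u = x) →
        cupTail F (latticePathTail v π) = 0 := by
      intro π v x hπ hx
      obtain ⟨i, hi⟩ := Fin.exists_succ_eq.2 hπ
      rw [cupTail, Finset.prod_eq_zero (Finset.mem_univ i), mul_zero]
      rw [hi, hx _ (htail π v _), hx _ (htail π v _), CharTwo.add_self_eq_zero]
    rw [← Equiv.Perm.decomposeFin.symm.sum_comp, Fintype.sum_prod_type, Fin.sum_univ_succ]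
    have hrest : ∑ i : Fin d, ∑ τ : Equiv.Perm (Fin d), ∑ w : Fin d → Fin N,
        (cupTail F (latticePathTail
          ((Equiv.Perm.decomposeFin.symm (i.succ, τ) 0).insertNth N fun i => (w i : ℕ))
            (Equiv.Perm.decomposeFin.symm (i.succ, τ))) +
          cupTail F (latticePathTail
          ((Equiv.Perm.decomposeFin.symm (i.succ, τ) 0).insertNth 0 fun i => (w i : ℕ))
            (Equiv.Perm.decomposeFin.symm (i.succ, τ)))) = 0 := by
      refine Finset.sum_eq_zero fun i _ => Finset.sum_eq_zero fun τ _ =>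
        Finset.sum_eq_zero fun w _ => ?_
      rw [hvanish _ _ 1 (by simp) (fun u hu => hF1 _ _ (by simpa using hu)),
        hvanish _ _ 0 (by simp) (fun u hu => hF0 _ _ (by simpa using hu)), add_zero]
    rw [hrest, add_zero, Finset.sum_comm]
    rw [← ih (fun i u => F i.succ (Fin.cons N u)) (fun i v hv => hF0 _ _ (by simpa using hv))
      (fun i v hv => hF1 _ _ (by simpa using hv))]
    refine Finset.sum_congr rfl fun w _ => Finset.sum_congr rfl fun τ _ => ?_
    simp only [Equiv.Perm.decomposeFin_symm_apply_zero, Fin.insertNth_zero', cupTail, cupCount,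
      latticePathTail_decomposeFin]
    rw [hF1 0 _ (by simp), hF0 0 _ (by simp)]
    simp

lemma exists_path_of_cupCount {n N : ℕ} (F : Fin n → (Fin n → ℕ) → ZMod 2)
    (h0 : ∀ i v, v i = 0 → F i v = 0) (h1 : ∀ i v, v i = N → F i v = 1) :
    ∃ (v : Fin n → ℕ) (π : Equiv.Perm (Fin n)), (∀ k, v k < N) ∧
      ∀ i : Fin n, F i (latticePath v π (i + 1)) ≠ F i (latticePath v π i) := by
  have h : ∑ v : Fin n → Fin N, ∑ π : Equiv.Perm (Fin n),
      cupCount F (latticePath (fun i => (v i : ℕ)) π) ≠ 0 := by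
    rw [sum_cupCount_eq_one N n F h0 h1]
    exact one_ne_zero
  obtain ⟨v, -, hv⟩ := Finset.exists_ne_zero_of_sum_ne_zero h
  obtain ⟨π, -, hπ⟩ := Finset.exists_ne_zero_of_sum_ne_zero hv
  refine ⟨fun i => v i, π, fun k => (v k).isLt, fun i hi => hπ ?_⟩
  refine Finset.prod_eq_zero (Finset.mem_univ i) ?_
  rw [hi, CharTwo.add_self_eq_zero]

/-- The **Poincaré–Miranda theorem** on the unit cube. -/
theorem poincare_miranda {n : ℕ} (F : (Fin n → ℝ) → Fin n → ℝ) (hF : Continuous F)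
    (h0 : ∀ x ∈ Icc (0 : Fin n → ℝ) 1, ∀ i, x i = 0 → F x i < 0)
    (h1 : ∀ x ∈ Icc (0 : Fin n → ℝ) 1, ∀ i, x i = 1 → 0 < F x i) :
    ∃ x ∈ Icc (0 : Fin n → ℝ) 1, F x = 0 := by
  by_contra! hne
  have hcomp : IsCompact (Icc (0 : Fin n → ℝ) 1) := isCompact_Icc
  obtain ⟨x₀, hx₀, hmin⟩ := hcomp.exists_isMinOn (nonempty_Icc.2 zero_le_one) hF.norm.continuousOn
  obtain ⟨δ, hδ⟩ : ∃ δ, δ = ‖F x₀‖ := ⟨_, rfl⟩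
  have hδpos : 0 < δ := hδ ▸ norm_pos_iff.2 (hne x₀ hx₀)
  obtain ⟨η, hη, hunif⟩ := Metric.uniformContinuousOn_iff.1
    (hcomp.uniformContinuousOn_of_continuous hF.continuousOn) δ hδpos
  obtain ⟨m, hm⟩ := exists_nat_one_div_lt hη
  obtain ⟨N, hN⟩ : ∃ N, N = m + 1 := ⟨_, rfl⟩
  have hNpos : (0 : ℝ) < N := by rw [hN]; positivity
  have hNη : 1 / (N : ℝ) < η := by rw [hN]; exact_mod_cast hm
  let s : (Fin n → ℕ) → Fin n → ℝ := fun v k => v k / N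
  have hs : ∀ v, (∀ k, v k ≤ N) → s v ∈ Icc (0 : Fin n → ℝ) 1 := by
    intro v hv
    refine ⟨fun k => by simp only [s]; positivity, fun k => ?_⟩
    simp only [s, Pi.one_apply]
    rw [div_le_one hNpos]
    exact_mod_cast hv k
  let L : Fin n → (Fin n → ℕ) → ZMod 2 := fun i v =>
    if v i = 0 then 0 else if v i = N then 1 else if F (s v) i < 0 then 0 else 1
  have hL0 : ∀ i v, (∀ k, v k ≤ N) → L i v = 0 → F (s v) i < 0 := by
    intro i v hv h
    simp only [L] at h
    split_ifs at h with h2 h3 h4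
    · exact h0 _ (hs v hv) i (by simp [s, h2])
    · exact absurd h one_ne_zero
    · exact h4
    · exact absurd h one_ne_zero
  have hL1 : ∀ i v, (∀ k, v k ≤ N) → L i v ≠ 0 → 0 ≤ F (s v) i := by
    intro i v hv h
    simp only [L] at h
    split_ifs at h with h2 h3 h4
    · exact absurd rfl h
    · exact (h1 _ (hs v hv) i (by simp [s, h3, hNpos.ne'])).le
    · exact absurd rfl h
    · exact not_lt.1 h4
  obtain ⟨v, π, hv, hvπ⟩ := exists_path_of_cupCount (N := N) L (fun i v h => by simp [L, h])
    (fun i v h => by simp [L, h, hN])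
  have hpath : ∀ j k, latticePath v π j k ≤ N := by
    intro j k
    have := hv k
    simp only [latticePath]
    split_ifs <;> omega
  have hdist : ∀ j, dist (F (s v)) (F (s (latticePath v π j))) < δ := by
    intro j
    refine hunif _ (hs v fun k => (hv k).le) _ (hs _ (hpath j)) (lt_of_le_of_lt ?_ hNη)
    rw [dist_pi_le_iff (by positivity)]
    intro k
    simp only [s, latticePath, Real.dist_eq, ← sub_div, abs_div, abs_of_pos hNpos]
    gcongr
    split_ifs <;> simp
  have hlt : ‖F (s v)‖ < δ := by
    rw [pi_norm_lt_iff hδpos]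
    intro i
    have hd : ∀ j, |F (s v) i - F (s (latticePath v π j)) i| < δ := fun j =>
      lt_of_le_of_lt (dist_le_pi_dist (F (s v)) _ i) (hdist j)
    have ha := abs_lt.1 (hd i)
    have hb := abs_lt.1 (hd (i + 1))
    rw [Real.norm_eq_abs, abs_lt]
    by_cases hi : L i (latticePath v π i) = 0
    · have h2 := hL0 i _ (hpath i) hi
      have h3 := hL1 i _ (hpath (i + 1)) (by rw [← hi]; exact hvπ i)
      constructor <;> linarith
    · have h2 := hL1 i _ (hpath i) hi
      have h3 := hL0 i _ (hpath (i + 1)) (by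
        by_contra h4
        have : ∀ a b : ZMod 2, a ≠ 0 → b ≠ 0 → a = b := by decide
        exact hvπ i (this _ _ h4 hi))
      constructor <;> linarith
  have hle : ‖F x₀‖ ≤ ‖F (s v)‖ := hmin (hs v fun k => (hv k).le)
  linarith [hδ]

section SmallInductiveDimension

universe u v

lemma indBelow_succ_iff {n : ℕ} {X : Type u} [TopologicalSpace X] :
    indBelow (n + 1) X ↔ ∀ (x : X) (U : Set X), IsOpen U → x ∈ U →
      ∃ V : Set X, IsOpen V ∧ x ∈ V ∧ V ⊆ U ∧ indBelow n ↥(frontier V) :=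
  Iff.rfl

lemma indBelow_of_isEmpty (n : ℕ) (X : Type u) [TopologicalSpace X] [IsEmpty X] :
    indBelow n X := by
  cases n with
  | zero => assumption
  | succ n => exact fun x => isEmptyElim x

lemma indBelow.succ {n : ℕ} : ∀ {X : Type u} [TopologicalSpace X], indBelow n X →
    indBelow (n + 1) X := by
  induction n with
  | zero =>
    intro X _ h
    have : IsEmpty X := h
    exact indBelow_of_isEmpty _ _
  | succ n ih =>
    intro X _ h x U hU hx
    obtain ⟨V, hV, hxV, hVU, hind⟩ := h x U hU hx
    exact ⟨V, hV, hxV, hVU, ih hind⟩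

lemma indBelow.mono {m n : ℕ} (hmn : m ≤ n) {X : Type u} [TopologicalSpace X]
    (h : indBelow m X) : indBelow n X := by
  induction hmn with
  | refl => exact h
  | step _ ih => exact ih.succ

lemma indBelow.of_isInducing {n : ℕ} : ∀ {X : Type u} {Y : Type v} [TopologicalSpace X]
    [TopologicalSpace Y] {e : X → Y}, IsInducing e → indBelow n Y → indBelow n X := by
  induction n with
  | zero =>
    intro X Y _ _ e _ h
    have : IsEmpty Y := h
    exact Function.isEmpty e
  | succ n ih =>
    intro X Y _ _ e he h x U hU hx
    obtain ⟨O, hO, rfl⟩ := he.isOpen_iff.1 hU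
    obtain ⟨V, hV, hxV, hVO, hind⟩ := h (e x) O hO hx
    refine ⟨e ⁻¹' V, hV.preimage he.continuous, hxV, preimage_mono hVO, ?_⟩
    have hmap : MapsTo e (frontier (e ⁻¹' V)) (frontier V) :=
      fun y hy => he.continuous.frontier_preimage_subset V hy
    refine ih (e := hmap.restrict) ?_ hind
    rw [IsInducing.subtypeVal.of_comp_iff.symm]
    exact he.comp IsInducing.subtypeVal

/-- Every continuous map to `ℝⁿ` has a perturbation, arbitrarily small on `S`, without zeros
in `S`. -/
def ZeroUnstableOn {X : Type u} [TopologicalSpace X] (n : ℕ) (S : Set X) : Prop :=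
  ∀ f : X → Fin n → ℝ, Continuous f → ∀ ε > 0, ∃ g : X → Fin n → ℝ, Continuous g ∧
    ∀ x ∈ S, dist (g x) (f x) < ε ∧ g x ≠ 0

/-- A map which is close to `f` on `S` can be changed outside `S` to be close to `f`
everywhere. -/
lemma exists_close_eqOn {X : Type u} [TopologicalSpace X] {ι : Type*} [Fintype ι]
    {f g : X → ι → ℝ}
    (hf : Continuous f) (hg : Continuous g) {S : Set X} {ε : ℝ} (hε : 0 ≤ ε)
    (h : ∀ x ∈ S, dist (g x) (f x) ≤ ε) :
    ∃ k : X → ι → ℝ, Continuous k ∧ (∀ x ∈ S, k x = g x) ∧ ∀ x, dist (k x) (f x) ≤ ε := by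
  refine ⟨fun x i => max (f x i - ε) (min (f x i + ε) (g x i)), by fun_prop, ?_, ?_⟩
  · intro x hx
    funext i
    have := abs_le.1 ((Real.dist_eq _ _) ▸ (dist_le_pi_dist (g x) (f x) i).trans (h x hx))
    change max (f x i - ε) (min (f x i + ε) (g x i)) = g x i
    rw [min_eq_right (by linarith), max_eq_right (by linarith)]
  · intro x
    rw [dist_pi_le_iff hε]
    intro i
    rw [Real.dist_eq, abs_le]
    constructor
    · linarith [le_max_left (f x i - ε) (min (f x i + ε) (g x i))]
    · have : max (f x i - ε) (min (f x i + ε) (g x i)) ≤ f x i + ε :=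
        max_le (by linarith) (min_le_left _ _)
      linarith

lemma ZeroUnstableOn.union {X : Type u} [TopologicalSpace X] {n : ℕ} {S T : Set X}
    (hSc : IsCompact S) (hS : ZeroUnstableOn n S) (hT : ZeroUnstableOn n T) :
    ZeroUnstableOn n (S ∪ T) := by
  intro f hf ε hε
  obtain ⟨g₀, hg₀, hg₀S⟩ := hS f hf (ε / 4) (by linarith)
  obtain ⟨g, hg, hgS, hgf⟩ := exists_close_eqOn hf hg₀ (S := S) (ε := ε / 4) (by linarith)
    fun x hx => (hg₀S x hx).1.le
  obtain ⟨m, hm, hmS⟩ : ∃ m > 0, ∀ x ∈ S, m ≤ ‖g x‖ := by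
    rcases S.eq_empty_or_nonempty with rfl | hne
    · exact ⟨1, one_pos, by simp⟩
    · obtain ⟨x₀, hx₀, hmin⟩ := hSc.exists_isMinOn hne hg.norm.continuousOn
      refine ⟨‖g x₀‖, norm_pos_iff.2 ?_, fun x hx => hmin hx⟩
      rw [hgS x₀ hx₀]
      exact (hg₀S x₀ hx₀).2
  have hδ : 0 < min (ε / 4) (m / 2) := lt_min (by linarith) (by linarith)
  obtain ⟨k₀, hk₀, hk₀T⟩ := hT g hg _ hδ
  obtain ⟨k, hk, hkT, hkg⟩ := exists_close_eqOn hg hk₀ (S := T) hδ.le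
    fun x hx => (hk₀T x hx).1.le
  refine ⟨k, hk, fun x hx => ⟨?_, ?_⟩⟩
  · have := dist_triangle (k x) (g x) (f x)
    linarith [hkg x, hgf x, min_le_left (ε / 4) (m / 2)]
  · rcases hx with hx | hx
    · intro h0
      have h1 := hkg x
      rw [h0, dist_zero_left] at h1
      linarith [hmS x hx, min_le_right (ε / 4) (m / 2)]
    · rw [hkT x hx]
      exact (hk₀T x hx).2

lemma ZeroUnstableOn.empty {X : Type u} [TopologicalSpace X] (n : ℕ) :
    ZeroUnstableOn n (∅ : Set X) :=
  fun f hf _ _ => ⟨f, hf, by simp⟩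

lemma ZeroUnstableOn.biUnion_finset {X : Type u} [TopologicalSpace X] {n : ℕ} {ι : Type*}
    (t : Finset ι) {S : ι → Set X} (hSc : ∀ i, IsCompact (S i))
    (hS : ∀ i, ZeroUnstableOn n (S i)) : ZeroUnstableOn n (⋃ i ∈ t, S i) := by
  classical
  induction t using Finset.induction_on with
  | empty => simpa using ZeroUnstableOn.empty n
  | insert a t _ ih =>
    rw [Finset.set_biUnion_insert]
    exact (hS a).union (hSc a) ih

lemma exists_continuous_zero_iff_mem_closure {X : Type u} [MetricSpace X] (A : Set X) :
    ∃ d : X → ℝ, Continuous d ∧ (∀ x, 0 ≤ d x) ∧ ∀ x, d x = 0 ↔ x ∈ closure A := by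
  rcases A.eq_empty_or_nonempty with rfl | hne
  · exact ⟨fun _ => 1, continuous_const, fun _ => zero_le_one, by simp⟩
  · exact ⟨fun x => infDist x A, continuous_infDist_pt A, fun _ => infDist_nonneg,
      fun x => (mem_closure_iff_infDist_zero hne).symm⟩

theorem zeroUnstableOn_of_indBelow {X : Type u} [MetricSpace X] {n : ℕ} :
    ∀ {S : Set X}, IsCompact S → indBelow n S → ZeroUnstableOn n S := by
  induction n with
  | zero =>
    intro S _ h
    have : IsEmpty S := h
    rw [isEmpty_coe_sort.1 this]
    exact ZeroUnstableOn.empty 0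
  | succ n ih =>
    intro S hSc hind f hf ε hε
    have : CompactSpace S := isCompact_iff_compactSpace.1 hSc
    have hf0 : Continuous fun y => f y 0 := (continuous_apply 0).comp hf
    have hnhds : ∀ x : S, ∃ V : Set S, IsOpen V ∧ x ∈ V ∧
        V ⊆ {y | |f y 0 - f x 0| < ε / 8} ∧ indBelow n ↥(frontier V) := by
      intro x
      refine hind x _ (isOpen_lt (by fun_prop) continuous_const) ?_
      simp; linarith
    choose V hVo hxV hVW hVind using hnhds
    obtain ⟨t, ht⟩ := isCompact_univ.elim_finite_subcover V hVo
      fun x _ => mem_iUnion.2 ⟨x, hxV x⟩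
    have hL : ZeroUnstableOn n (⋃ x ∈ t, (Subtype.val '' frontier (V x) : Set X)) := by
      refine ZeroUnstableOn.biUnion_finset t
        (fun x => isClosed_frontier.isCompact.image continuous_subtype_val) fun x => ?_
      refine ih (isClosed_frontier.isCompact.image continuous_subtype_val) ?_
      exact (hVind x).of_isInducing
        (Topology.IsEmbedding.subtypeVal.homeomorphImage (frontier (V x))).symm.isInducing
    obtain ⟨L, hLdef⟩ : ∃ L, L = ⋃ x ∈ t, (Subtype.val '' frontier (V x) : Set X) := ⟨_, rfl⟩
    rw [← hLdef] at hL
    let U : Set S := ⋃ x ∈ {x : S | x ∈ t ∧ f x 0 < 0}, V x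
    have hUlt : ∀ y ∈ U, f y 0 < ε / 8 := by
      intro y hy
      simp only [U, mem_iUnion, mem_ofPred_eq] at hy
      obtain ⟨x, ⟨-, hx⟩, hyx⟩ := hy
      have := (abs_lt.1 (mem_ofPred_eq ▸ hVW x hyx)).2
      linarith
    have hUgt : ∀ y ∉ U, -(ε / 8) < f y 0 := by
      intro y hy
      have hy' := ht (mem_univ y)
      simp only [U, mem_iUnion, mem_ofPred_eq] at hy hy'
      obtain ⟨x, hxt, hyx⟩ := hy'
      have h1 : 0 ≤ f x 0 := by
        by_contra h
        exact hy ⟨x, ⟨hxt, not_le.1 h⟩, hyx⟩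
      have := (abs_lt.1 (mem_ofPred_eq ▸ hVW x hyx)).1
      linarith
    have hUo : IsOpen U := isOpen_biUnion fun x _ => hVo x
    have hUfr : ∀ y ∈ closure U, y ∉ U → (y : X) ∈ L := by
      intro y hy hyU
      have hfin : {x | x ∈ t ∧ f x 0 < 0}.Finite := t.finite_toSet.subset fun x hx => hx.1
      rw [hfin.closure_biUnion] at hy
      obtain ⟨x, hx, hyx⟩ := mem_iUnion₂.1 hy
      rw [hLdef]
      refine mem_iUnion₂.2 ⟨x, hx.1, y, ?_, rfl⟩
      rw [(hVo x).frontier_eq]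
      exact ⟨hyx, fun h => hyU (mem_iUnion₂.2 ⟨x, hx, h⟩)⟩
    obtain ⟨g₀, hg₀, hg₀L⟩ := hL (fun x => Fin.tail (f x)) (by fun_prop) (ε / 4) (by linarith)
    obtain ⟨g, hg, hgL, hgf⟩ := exists_close_eqOn (by fun_prop) hg₀ (S := L)
      (ε := ε / 4) (by linarith) fun x hx => (hg₀L x hx).1.le
    obtain ⟨a, ha, ha0, haU⟩ := exists_continuous_zero_iff_mem_closure (Subtype.val '' U)
    obtain ⟨b, hb, hb0, hbU⟩ := exists_continuous_zero_iff_mem_closure (Subtype.val '' Uᶜ)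
    let k : X → ℝ := fun x => f x 0 - max (-(ε / 8)) (min (f x 0) (ε / 8)) +
      max (-(ε / 4)) (min (a x - b x) (ε / 4))
    have hk : Continuous k := by fun_prop
    refine ⟨fun x => Fin.cons (k x) (g x), ?_, ?_⟩
    · refine continuous_pi fun i => ?_
      refine Fin.cases ?_ (fun i => ?_) i
      · simpa using hk
      · simp only [Fin.cons_succ]; fun_prop
    · intro x hx
      constructor
      · refine lt_of_le_of_lt ?_ (half_lt_self hε)
        rw [dist_pi_le_iff (by linarith)]
        intro i
        refine Fin.cases ?_ (fun i => ?_) i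
        · simp only [Fin.cons_zero, k, Real.dist_eq]
          have h1 : |max (-(ε / 8)) (min (f x 0) (ε / 8))| ≤ ε / 8 :=
            abs_le.2 ⟨le_max_left _ _, max_le (by linarith) (min_le_right _ _)⟩
          have h2 : |max (-(ε / 4)) (min (a x - b x) (ε / 4))| ≤ ε / 4 :=
            abs_le.2 ⟨le_max_left _ _, max_le (by linarith) (min_le_right _ _)⟩
          rw [abs_le] at *
          constructor <;> linarith [h1.1, h1.2, h2.1, h2.2]
        · have := (dist_le_pi_dist (g x) (Fin.tail (f x)) i).trans (hgf x)
          simp only [Fin.cons_succ]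
          exact this.trans (by linarith)
      · intro h0
        have hk0 : k x = 0 := by simpa using congrFun h0 0
        have hg0 : g x = 0 := by
          funext i; simpa using congrFun h0 i.succ
        have hxL : x ∈ L := by
          obtain ⟨y, rfl⟩ : ∃ y : S, (y : X) = x := ⟨⟨x, hx⟩, rfl⟩
          by_cases hy : y ∈ U
          · exfalso
            have ha' : a y = 0 := (haU y).2 (subset_closure ⟨y, hy, rfl⟩)
            have hb' : 0 < b y := by
              refine (hb0 y).lt_of_ne fun h => ?_
              have := (hbU y).1 h.symm
              rw [← closure_subtype, hUo.isClosed_compl.closure_eq] at this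
              exact this hy
            have h1 : f y 0 ≤ max (-(ε / 8)) (min (f y 0) (ε / 8)) := by
              rw [min_eq_left (hUlt y hy).le]; exact le_max_right _ _
            have h2 : max (-(ε / 4)) (min (a y - b y) (ε / 4)) < 0 :=
              max_lt (by linarith) ((min_le_left _ _).trans_lt (by linarith))
            simp only [k] at hk0
            linarith
          · by_contra hyL
            have hb' : b y = 0 := (hbU y).2 (subset_closure ⟨y, hy, rfl⟩)
            have ha' : 0 < a y := by
              refine (ha0 y).lt_of_ne fun h => ?_
              have := (haU y).1 h.symm
              rw [← closure_subtype] at this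
              exact hyL (hUfr y this hy)
            have h1 : max (-(ε / 8)) (min (f y 0) (ε / 8)) ≤ f y 0 :=
              max_le (hUgt y hy).le (min_le_left _ _)
            have h2 : 0 < max (-(ε / 4)) (min (a y - b y) (ε / 4)) :=
              lt_max_of_lt_right (lt_min (by linarith) (by linarith))
            simp only [k] at hk0
            linarith
        exact (hg₀L x hxL).2 (by rw [← hgL x hxL, hg0])

end SmallInductiveDimension

section GenericZeroSets

universe u

lemma dense_setOf_zeroUnstable_step {X : Type u} [MetricSpace X] [CompactSpace X] {n : ℕ}
    {T : Set X} (hT : ZeroUnstableOn (n + 1) T) (f : C(X, Fin n → ℝ)) {ε : ℝ} (hε : 0 < ε) :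
    Dense {g : C(X, ℝ) | ∃ k : X → Fin n → ℝ, Continuous k ∧
      ∀ x ∈ T, dist (k x) (f x) < ε ∧ (g x = 0 → k x ≠ 0)} := by
  rw [Metric.dense_iff]
  intro g r hr
  have hf₁ : Continuous fun x => (Fin.cons (g x) (f x) : Fin (n + 1) → ℝ) := by
    refine continuous_pi fun i => ?_
    refine Fin.cases ?_ (fun i => ?_) i
    · simpa using g.continuous
    · simp only [Fin.cons_succ]; fun_prop
  have hδ : 0 < min (r / 2) ε := lt_min (by linarith) hε
  obtain ⟨h₀, hh₀, hh₀T⟩ := hT _ hf₁ _ hδ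
  obtain ⟨h, hh, hhT, hhf⟩ := exists_close_eqOn hf₁ hh₀ (S := T) hδ.le
    fun x hx => (hh₀T x hx).1.le
  refine ⟨⟨fun x => h x 0, by fun_prop⟩, ?_, fun x => Fin.tail (h x), by fun_prop,
    fun x hx => ⟨?_, ?_⟩⟩
  · rw [mem_ball, ContinuousMap.dist_lt_iff hr]
    intro x
    have := (dist_le_pi_dist (h x) _ 0).trans (hhf x)
    simp only [Fin.cons_zero] at this
    exact (this.trans (min_le_left _ _)).trans_lt (by linarith)
  · rw [dist_pi_lt_iff hε]
    intro i
    have h1 := dist_le_pi_dist (h x) (Fin.cons (g x) (f x) : Fin (n + 1) → ℝ) i.succ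
    rw [hhT x hx] at h1
    simp only [Fin.cons_succ] at h1
    have h2 := h1.trans_lt ((hh₀T x hx).1.trans_le (min_le_right _ _))
    rwa [← hhT x hx] at h2
  · intro h0 htail
    apply (hh₀T x hx).2
    rw [← hhT x hx]
    funext i
    refine Fin.cases h0 (fun i => ?_) i
    exact congrFun htail i

lemma isOpen_setOf_zeroUnstable_step {X : Type u} [MetricSpace X] [CompactSpace X] {n : ℕ}
    {T : Set X} (hTc : IsClosed T) (f : C(X, Fin n → ℝ)) (ε : ℝ) :
    IsOpen {g : C(X, ℝ) | ∃ k : X → Fin n → ℝ, Continuous k ∧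
      ∀ x ∈ T, dist (k x) (f x) < ε ∧ (g x = 0 → k x ≠ 0)} := by
  rw [Metric.isOpen_iff]
  rintro g ⟨k, hk, hkT⟩
  obtain ⟨m, hm, hmT⟩ : ∃ m > 0, ∀ x ∈ T, m ≤ |g x| + ‖k x‖ := by
    rcases T.eq_empty_or_nonempty with rfl | hne
    · exact ⟨1, one_pos, by simp⟩
    · obtain ⟨x₀, hx₀, hmin⟩ := hTc.isCompact.exists_isMinOn (f := fun x => |g x| + ‖k x‖) hne
        (by fun_prop)
      refine ⟨|g x₀| + ‖k x₀‖, ?_, fun x hx => hmin hx⟩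
      by_cases h0 : g x₀ = 0
      · have := norm_pos_iff.2 ((hkT x₀ hx₀).2 h0)
        positivity
      · have := abs_pos.2 h0
        positivity
  refine ⟨m, hm, fun g' hg' => ⟨k, hk, fun x hx => ⟨(hkT x hx).1, fun h0 hk0 => ?_⟩⟩⟩
  have h1 := (ContinuousMap.dist_apply_le_dist x).trans_lt (mem_ball.1 hg')
  have h2 := hmT x hx
  rw [h0, dist_zero_left, Real.norm_eq_abs] at h1
  rw [hk0, norm_zero] at h2
  linarith

lemma dense_setOf_zeroUnstableOn_zeros {X : Type u} [MetricSpace X] [CompactSpace X] {n : ℕ}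
    {T : Set X} (hTc : IsClosed T) (hT : ZeroUnstableOn (n + 1) T) :
    Dense {g : C(X, ℝ) | ZeroUnstableOn n (T ∩ {x | g x = 0})} := by
  let D : ℕ → C(X, Fin n → ℝ) := denseSeq _
  have hdense : Dense (⋂ p : ℕ × ℕ, {g : C(X, ℝ) | ∃ k : X → Fin n → ℝ, Continuous k ∧
      ∀ x ∈ T, dist (k x) (D p.1 x) < 1 / ((p.2 : ℝ) + 1) ∧ (g x = 0 → k x ≠ 0)}) :=
    dense_iInter_of_isOpen (fun p => isOpen_setOf_zeroUnstable_step hTc _ _)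
      fun p => dense_setOf_zeroUnstable_step hT _ (by positivity)
  refine hdense.mono fun g hg => ?_
  rw [mem_ofPred_eq]
  intro f hf ε hε
  obtain ⟨j, hj⟩ := (denseRange_denseSeq C(X, Fin n → ℝ)).exists_dist_lt
    (⟨f, hf⟩ : C(X, Fin n → ℝ)) (half_pos hε)
  obtain ⟨m, hm⟩ := exists_nat_one_div_lt (half_pos hε)
  obtain ⟨k, hk, hkT⟩ := mem_iInter.1 hg (j, m)
  refine ⟨k, hk, fun x hx => ⟨?_, (hkT x hx.1).2 hx.2⟩⟩
  have h1 : dist (f x) (D j x) ≤ _ :=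
    ContinuousMap.dist_apply_le_dist (f := (⟨f, hf⟩ : C(X, Fin n → ℝ))) (g := D j) x
  have h2 := (hkT x hx.1).1
  have h3 := dist_triangle (k x) (D j x) (f x)
  rw [dist_comm (D j x)] at h3
  change dist (⟨f, hf⟩ : C(X, Fin n → ℝ)) (D j) < _ at hj
  simp only at h2
  linarith

theorem indBelow_of_locally_zeroUnstableOn {X : Type u} [MetricSpace X] [CompactSpace X] {n : ℕ} :
    ∀ {S : Set X}, IsClosed S →
      (∀ x ∈ S, ∃ N ∈ 𝓝 x, IsClosed N ∧ ZeroUnstableOn n (S ∩ N)) → indBelow n S := by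
  induction n with
  | zero =>
    intro S _ h
    refine isEmpty_coe_sort.2 (eq_empty_of_forall_notMem fun x hx => ?_)
    obtain ⟨N, hN, -, hz⟩ := h x hx
    obtain ⟨g, -, hg⟩ := hz (fun _ _ => 0) continuous_const 1 one_pos
    exact (hg x ⟨hx, mem_of_mem_nhds hN⟩).2 (Subsingleton.elim _ _)
  | succ n ih =>
    intro S hS h
    rw [indBelow_succ_iff]
    rintro ⟨x, hxS⟩ U hU hxU
    obtain ⟨O, hO, rfl⟩ := isOpen_induced_iff.1 hU
    obtain ⟨N, hN, hNc, hz⟩ := h x hxS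
    obtain ⟨ρ, hρ, hball⟩ := Metric.mem_nhds_iff.1 (inter_mem (hO.mem_nhds hxU) hN)
    let g₀ : C(X, ℝ) := ⟨fun y => dist y x - ρ / 2, by fun_prop⟩
    obtain ⟨g, hgz, hg⟩ := (dense_setOf_zeroUnstableOn_zeros (hS.inter hNc) hz).exists_dist_lt g₀
      (ε := ρ / 4) (by linarith)
    have hgg : ∀ y, |dist y x - ρ / 2 - g y| < ρ / 4 := fun y =>
      (ContinuousMap.dist_apply_le_dist (f := g₀) (g := g) y).trans_lt hg
    have hnear : ∀ y, g y ≤ 0 → dist y x < ρ := by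
      intro y hy
      have := (abs_lt.1 (hgg y)).2
      linarith
    have hgc : Continuous fun y : S => g y := by fun_prop
    refine ⟨{y : S | g y < 0}, isOpen_lt hgc continuous_const, ?_, ?_, ?_⟩
    · have := (abs_lt.1 (hgg x)).1
      rw [dist_self] at this
      simp only [mem_ofPred_eq]
      linarith
    · intro y hy
      exact (hball (mem_ball.2 (hnear y hy.le))).1
    · have hfr : ∀ y ∈ frontier {y : S | g y < 0}, (y : X) ∈ S ∩ N ∩ {x | g x = 0} := by
        intro y hy
        have h0 : g y = 0 := frontier_lt_subset_eq hgc continuous_const hy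
        exact ⟨⟨y.2, (hball (mem_ball.2 (hnear y h0.le))).2⟩, h0⟩
      have hind : indBelow n ↥(S ∩ N ∩ {x | g x = 0}) := by
        refine ih ((hS.inter hNc).inter (isClosed_eq g.continuous continuous_const)) ?_
        intro y _
        exact ⟨univ, univ_mem, isClosed_univ, by rw [inter_univ]; exact hgz⟩
      have hval : IsInducing fun y : ↥(frontier {y : S | g y < 0}) => (y.1.1 : X) :=
        IsInducing.subtypeVal.comp IsInducing.subtypeVal
      let e : ↥(frontier {y : S | g y < 0}) → ↥(S ∩ N ∩ {x | g x = 0}) :=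
        fun y => ⟨y.1.1, hfr y.1 y.2⟩
      exact hind.of_isInducing (e := e) ((IsInducing.subtypeVal.of_comp_iff (f := e)).1 hval)

/-- `c` is a value which all maps that are `δ`-close to `f` attain. -/
def StableValue {X : Type u} [TopologicalSpace X] [CompactSpace X] {n : ℕ}
    (f : C(X, Fin n → ℝ)) (δ : ℝ) (c : Fin n → ℝ) : Prop :=
  ∀ g : C(X, Fin n → ℝ), dist g f ≤ δ → c ∈ range g

lemma StableValue.ball_subset {X : Type u} [MetricSpace X] [CompactSpace X] {n : ℕ}
    {f g : C(X, Fin n → ℝ)} {δ : ℝ} {c : Fin n → ℝ} (h : StableValue f δ c)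
    (hg : dist g f ≤ δ / 2) : ball c (δ / 2) ⊆ range g := by
  intro y hy
  have hδ : 0 < δ / 2 := dist_nonneg.trans_lt (mem_ball.1 hy)
  obtain ⟨x, hx⟩ := h (g + ContinuousMap.const X (c - y)) (by
    rw [ContinuousMap.dist_le (by linarith)]
    intro x
    have h1 := (ContinuousMap.dist_apply_le_dist (f := g) (g := f) x).trans hg
    have h2 : dist ((g + ContinuousMap.const X (c - y)) x) (g x) = dist y c := by
      simp [dist_eq_norm, norm_sub_rev]
    have h3 := dist_triangle ((g + ContinuousMap.const X (c - y)) x) (g x) (f x)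
    linarith [mem_ball.1 hy])
  refine ⟨x, ?_⟩
  simp only [ContinuousMap.add_apply, ContinuousMap.const_apply] at hx
  have : g x = c - (c - y) := eq_sub_of_add_eq hx
  rw [this]; simp

theorem exists_stableValue_near {X : Type u} [MetricSpace X] [CompactSpace X] {n : ℕ}
    (hX : ¬ indBelow n X) (f : C(X, Fin n → ℝ)) {ε : ℝ} (hε : 0 < ε) :
    ∃ g, dist g f ≤ ε ∧ ∃ δ > 0, ∃ c, StableValue g δ c := by
  have h1 : ¬ indBelow n (univ : Set X) := fun h =>
    hX (h.of_isInducing (Homeomorph.Set.univ X).symm.isInducing)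
  obtain ⟨x, hx⟩ : ∃ x : X, ∀ N ∈ 𝓝 x, IsClosed N → ¬ ZeroUnstableOn n N := by
    by_contra! h
    refine h1 (indBelow_of_locally_zeroUnstableOn isClosed_univ fun x _ => ?_)
    obtain ⟨N, hN, hNc, hz⟩ := h x
    exact ⟨N, hN, hNc, by rwa [univ_inter]⟩
  have hN : f ⁻¹' closedBall (f x) (ε / 2) ∈ 𝓝 x :=
    f.continuous.continuousAt.preimage_mem_nhds (closedBall_mem_nhds _ (by linarith))
  have hz := hx _ hN (isClosed_closedBall.preimage f.continuous)
  obtain ⟨N, hNdef⟩ : ∃ N, N = f ⁻¹' closedBall (f x) (ε / 2) := ⟨_, rfl⟩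
  rw [← hNdef] at hz
  simp only [ZeroUnstableOn, not_forall] at hz
  obtain ⟨p, hp, δ, hδ, hpz⟩ := hz
  let P : C(X, Fin n → ℝ) := ⟨p, hp⟩
  obtain ⟨a, ha, hap⟩ : ∃ a > 0, a * ‖P‖ ≤ ε / 2 := by
    refine ⟨ε / 2 / (‖P‖ + 1), by positivity, ?_⟩
    rw [div_mul_eq_mul_div, div_le_iff₀ (by positivity)]
    nlinarith [norm_nonneg P]
  have hq : Continuous fun y => f x + a • p y := by fun_prop
  obtain ⟨k, hk, hkN, hkf⟩ := exists_close_eqOn f.continuous hq (S := N) hε.le (by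
    intro y hy
    rw [hNdef] at hy
    have h2 : dist (f x + a • p y) (f x) ≤ ε / 2 := by
      rw [dist_eq_norm, add_sub_cancel_left, norm_smul, Real.norm_eq_abs, abs_of_pos ha]
      exact (mul_le_mul_of_nonneg_left (P.norm_coe_le_norm y) ha.le).trans hap
    have h3 : dist (f y) (f x) ≤ ε / 2 := hy
    have := dist_triangle_right (f x + a • p y) (f y) (f x)
    linarith)
  refine ⟨⟨k, hk⟩, (ContinuousMap.dist_le hε.le).2 hkf, a * δ / 2, by positivity, f x, ?_⟩
  intro g hg
  by_contra hgx
  apply hpz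
  refine ⟨fun y => a⁻¹ • (g y - f x), by fun_prop, fun y hy => ⟨?_, fun h0 => ?_⟩⟩
  · have h2 : dist (g y) (k y) ≤ _ := (ContinuousMap.dist_apply_le_dist y).trans hg
    rw [hkN y hy] at h2
    have h3 : p y = a⁻¹ • (f x + a • p y - f x) := by
      rw [add_sub_cancel_left, smul_smul, inv_mul_cancel₀ ha.ne', one_smul]
    rw [h3, dist_smul₀, dist_sub_right, Real.norm_eq_abs, abs_of_pos (inv_pos.2 ha)]
    rw [inv_mul_lt_iff₀ ha]
    have : 0 < a * δ := by positivity
    linarith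
  · rcases smul_eq_zero.1 h0 with h | h
    · exact (inv_pos.2 ha).ne' h
    · exact hgx ⟨y, sub_eq_zero.1 h⟩

theorem eventually_residual_interior_nonempty {X : Type u} [MetricSpace X] [CompactSpace X]
    {n : ℕ} (hX : ¬ indBelow n X) :
    ∀ᶠ f : C(X, Fin n → ℝ) in residual C(X, Fin n → ℝ), (interior (range f)).Nonempty := by
  let W : Set C(X, Fin n → ℝ) := {g | ∃ f δ c, 0 < δ ∧ StableValue f δ c ∧ dist g f < δ / 2}
  have hW : IsOpen W := by
    rw [Metric.isOpen_iff]
    rintro g ⟨f, δ, c, hδ, hf, hg⟩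
    refine ⟨δ / 2 - dist g f, by linarith, fun g' hg' => ⟨f, δ, c, hδ, hf, ?_⟩⟩
    have := dist_triangle g' g f
    linarith [mem_ball.1 hg']
  have hWd : Dense W := by
    rw [Metric.dense_iff]
    intro f r hr
    obtain ⟨g, hg, δ, hδ, c, hc⟩ := exists_stableValue_near hX f (half_pos hr)
    refine ⟨g, mem_ball.2 (by linarith), g, δ, c, hδ, hc, ?_⟩
    rw [dist_self]; linarith
  refine mem_of_superset (residual_of_dense_open hW hWd) ?_
  rintro g ⟨f, δ, c, hδ, hf, hg⟩
  exact ⟨c, mem_interior.2 ⟨_, hf.ball_subset hg.le, isOpen_ball, mem_ball_self (by linarith)⟩⟩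

end GenericZeroSets

section LowerBound

theorem not_indBelow_frontier {d : ℕ} {A : Set (Fin (d + 1) → ℝ)} (hA : IsCompact A)
    (hint : (interior A).Nonempty) : ¬ indBelow d (frontier A) := by
  intro hind
  have hz : ZeroUnstableOn d (frontier A) :=
    zeroUnstableOn_of_indBelow (hA.of_isClosed_subset isClosed_frontier
      hA.isClosed.frontier_subset) hind
  obtain ⟨c, hc⟩ := hint
  obtain ⟨r, hr, hball⟩ := Metric.isOpen_iff.1 isOpen_interior c hc
  obtain ⟨R, hR⟩ := hA.isBounded.subset_ball c
  have hR0 : 0 < R := dist_nonneg.trans_lt (mem_ball.1 (hR (interior_subset hc)))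
  obtain ⟨g₀, hg₀, hg₀A⟩ := hz (fun x i => x i.succ - c i.succ) (by fun_prop) (r / 8)
    (by linarith)
  obtain ⟨g, hg, hgA, hgf⟩ := exists_close_eqOn (by fun_prop) hg₀ (S := frontier A)
    (ε := r / 8) (by linarith) fun x hx => (hg₀A x hx).1.le
  have hAne : A.Nonempty := ⟨c, interior_subset hc⟩
  have hAc : Aᶜ.Nonempty := by
    rw [nonempty_compl]
    rintro rfl
    have := hR (mem_univ (c + fun _ => R))
    rw [mem_ball, dist_eq_norm, add_sub_cancel_left, pi_norm_const, Real.norm_eq_abs,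
      abs_of_pos hR0] at this
    exact lt_irrefl _ this
  let s : (Fin (d + 1) → ℝ) → ℝ := fun x => infDist x A - infDist x Aᶜ
  have hs : Continuous s := (continuous_infDist_pt A).sub (continuous_infDist_pt _)
  let X : (Fin (d + 1) → ℝ) → Fin (d + 1) → ℝ := fun t =>
    Fin.cons (c 0 + R * t 0) fun i : Fin d => c i.succ + r / 2 * (t i.succ - 1 / 2)
  have hX : Continuous X := by
    refine continuous_pi fun i => ?_
    refine Fin.cases ?_ (fun i => ?_) i
    · simp only [X, Fin.cons_zero]; fun_prop
    · simp only [X, Fin.cons_succ]; fun_prop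
  obtain ⟨t, ht, h0⟩ := poincare_miranda
    (fun t => (Fin.cons (s (X t)) (g (X t)) : Fin (d + 1) → ℝ)) (by
      refine continuous_pi fun i => ?_
      refine Fin.cases ?_ (fun i => ?_) i
      · simp only [Fin.cons_zero]; fun_prop
      · simp only [Fin.cons_succ]; fun_prop)
    (by
      intro t ht i
      refine Fin.cases ?_ (fun i => ?_) i
      · intro hi
        have hXball : X t ∈ interior A := by
          apply hball
          rw [mem_ball, dist_pi_lt_iff hr]
          intro j
          refine Fin.cases ?_ (fun j => ?_) j
          · simpa [X, hi] using hr
          · have h1 := ht.1 j.succ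
            have h2 := ht.2 j.succ
            simp only [Pi.zero_apply, Pi.one_apply] at h1 h2
            simp only [X, Fin.cons_succ, Real.dist_eq, add_sub_cancel_left]
            rw [abs_lt]
            constructor <;> nlinarith
        have h1 : infDist (X t) A = 0 := infDist_zero_of_mem (interior_subset hXball)
        have h2 : 0 < infDist (X t) Aᶜ := by
          refine infDist_nonneg.lt_of_ne fun h => ?_
          have := (mem_closure_iff_infDist_zero hAc).2 h.symm
          rw [closure_compl] at this
          exact this hXball
        simp only [Fin.cons_zero, s]
        linarith
      · intro hi
        have h1 := (dist_le_pi_dist (g (X t)) _ i).trans (hgf (X t))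
        have h2 := abs_le.1 ((Real.dist_eq _ _) ▸ h1)
        simp only [X, Fin.cons_succ, hi] at h2 ⊢
        linarith [h2.2])
    (by
      intro t ht i
      refine Fin.cases ?_ (fun i => ?_) i
      · intro hi
        have h1 : infDist (X t) Aᶜ = 0 := by
          refine infDist_zero_of_mem fun h => ?_
          have h2 := (dist_le_pi_dist (X t) c 0).trans_lt (hR h)
          simp [X, hi, abs_of_pos hR0] at h2
        have h2 : 0 < infDist (X t) A := by
          refine infDist_nonneg.lt_of_ne fun h => ?_
          have h3 := (mem_closure_iff_infDist_zero hAne).2 h.symm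
          rw [hA.isClosed.closure_eq] at h3
          have h2 := (dist_le_pi_dist (X t) c 0).trans_lt (hR h3)
          simp [X, hi, abs_of_pos hR0] at h2
        simp only [Fin.cons_zero, s]
        linarith
      · intro hi
        have h1 := (dist_le_pi_dist (g (X t)) _ i).trans (hgf (X t))
        have h2 := abs_le.1 ((Real.dist_eq _ _) ▸ h1)
        simp only [X, Fin.cons_succ, hi] at h2 ⊢
        linarith [h2.1])
  have hs0 : s (X t) = 0 := by simpa using congrFun h0 0
  have hg0 : g (X t) = 0 := by
    funext i; simpa using congrFun h0 i.succ
  have hfr : X t ∈ frontier A := by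
    rw [frontier_eq_closure_inter_closure]
    rw [mem_inter_iff, mem_closure_iff_infDist_zero hAne, mem_closure_iff_infDist_zero hAc]
    by_cases hXA : X t ∈ A
    · have := infDist_zero_of_mem hXA
      exact ⟨this, by simp only [s] at hs0; linarith⟩
    · have := infDist_zero_of_mem (show X t ∈ Aᶜ from hXA)
      exact ⟨by simp only [s] at hs0; linarith, this⟩
  exact (hg₀A _ hfr).2 (by rw [← hgA _ hfr, hg0])

end LowerBound

section Szpilrajn

open MeasureTheory MeasureTheory.Measure

universe u

lemma ae_hausdorffMeasure_inter_sphere_eq_zero {X : Type u} [MetricSpace X] [MeasurableSpace X]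
    [BorelSpace X] {d : ℕ} {S : Set X} (hS : μH[((d + 1 : ℕ) : ℝ)] S = 0) (x : X) :
    ∀ᵐ r : ℝ, μH[(d : ℝ)] (S ∩ sphere x r) = 0 := by
  have hcov : ∀ k : ℕ, ∃ t : ℕ → Set X, S ⊆ ⋃ n, t n ∧ (∀ n, ediam (t n) ≤ (2⁻¹ : ℝ≥0∞) ^ k) ∧
      ∑' n, ⨆ _ : (t n).Nonempty, ediam (t n) ^ ((d + 1 : ℕ) : ℝ) < (2⁻¹ : ℝ≥0∞) ^ k := by
    intro k
    have hk : (0 : ℝ≥0∞) < 2⁻¹ ^ k := ENNReal.pow_pos (by simp) k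
    rw [hausdorffMeasure_apply] at hS
    have h1 := (iSup₂_le_iff.1 hS.le (2⁻¹ ^ k) hk).trans_lt hk
    simp only [iInf_lt_iff] at h1
    obtain ⟨t, ht, hd, hsum⟩ := h1
    exact ⟨t, ht, hd, hsum⟩
  choose t ht hdiam hsum using hcov
  let E : ℕ → ℕ → Set ℝ := fun k n => toMeasurable volume ((fun y => dist y x) '' t k n)
  have hE : ∀ k n, volume (E k n) ≤ ⨆ _ : (t k n).Nonempty, ediam (t k n) := by
    intro k n
    rw [measure_toMeasurable]
    rcases (t k n).eq_empty_or_nonempty with h | h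
    · simp [h]
    · rw [iSup_pos h]
      refine (Real.volume_le_diam _).trans ?_
      simpa using (LipschitzWith.dist_left x).ediam_image_le (t k n)
  let φ : ℕ → ℝ → ℝ≥0∞ := fun k r =>
    ∑' n, (E k n).indicator (fun _ => ediam (t k n) ^ (d : ℝ)) r
  have hφm : ∀ k, Measurable (φ k) := fun k =>
    Measurable.tsum fun n => measurable_const.indicator (measurableSet_toMeasurable _ _)
  have hφ : ∀ k, ∫⁻ r, φ k r ≤ (2⁻¹ : ℝ≥0∞) ^ k := by
    intro k
    rw [lintegral_tsum fun n =>
      (measurable_const.indicator (measurableSet_toMeasurable _ _)).aemeasurable]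
    refine le_trans (ENNReal.tsum_le_tsum fun n => ?_) (hsum k).le
    rw [lintegral_indicator_const (measurableSet_toMeasurable _ _)]
    refine (mul_le_mul_right (hE k n) _).trans ?_
    rcases (t k n).eq_empty_or_nonempty with h | h
    · simp [h]
    · rw [iSup_pos h, iSup_pos h, ENNReal.rpow_natCast, ENNReal.rpow_natCast, pow_succ]
  have hfin : ∫⁻ r, ∑' k, φ k r ≠ ∞ := by
    rw [lintegral_tsum fun k => (hφm k).aemeasurable]
    refine ((ENNReal.tsum_le_tsum hφ).trans_lt ?_).ne
    rw [ENNReal.tsum_geometric, ENNReal.one_sub_inv_two, inv_inv]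
    exact ENNReal.ofNat_lt_top
  filter_upwards [ae_lt_top (Measurable.tsum hφm) hfin] with r hr
  have htend : Tendsto (fun k => φ k r) atTop (𝓝 0) :=
    ENNReal.tendsto_atTop_zero_of_tsum_ne_top hr.ne
  refine le_antisymm ?_ zero_le
  have hle := hausdorffMeasure_le_liminf_tsum (d : ℝ) (S ∩ sphere x r) (l := atTop)
    (ι := fun k : ℕ => {n // r ∈ E k n}) (fun k => (2⁻¹ : ℝ≥0∞) ^ k)
    (ENNReal.tendsto_pow_atTop_nhds_zero_of_lt_one (by simp)) (fun k n => t k n)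
    (Eventually.of_forall fun k n => hdiam k n) (Eventually.of_forall fun k y hy => by
      obtain ⟨n, hn⟩ := mem_iUnion.1 (ht k hy.1)
      refine mem_iUnion.2 ⟨⟨n, subset_toMeasurable _ _ ⟨y, hn, hy.2⟩⟩, hn⟩)
  refine hle.trans (le_of_eq ?_)
  rw [← htend.liminf_eq]
  congr 1
  funext k
  exact tsum_subtype {n | r ∈ E k n} fun n => ediam (t k n) ^ (d : ℝ)

/-- **Szpilrajn's inequality**: a set of vanishing `d`-dimensional Hausdorff measure has small
inductive dimension less than `d`. -/
theorem indBelow_of_hausdorffMeasure_eq_zero {X : Type u} [MetricSpace X] [MeasurableSpace X]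
    [BorelSpace X] {d : ℕ} : ∀ {S : Set X}, μH[(d : ℝ)] S = 0 → indBelow d S := by
  induction d with
  | zero =>
    intro S hS
    refine isEmpty_coe_sort.2 (eq_empty_of_forall_notMem fun x hx => ?_)
    have h1 : μH[((0 : ℕ) : ℝ)] ({x} : Set X) = 0 :=
      measure_mono_null (singleton_subset_iff.2 hx) hS
    rw [Nat.cast_zero, hausdorffMeasure_zero_singleton] at h1
    exact one_ne_zero h1
  | succ d ih =>
    intro S hS
    rw [indBelow_succ_iff]
    rintro ⟨x, hxS⟩ U hU hxU
    obtain ⟨O, hO, rfl⟩ := isOpen_induced_iff.1 hU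
    obtain ⟨ρ, hρ, hball⟩ := Metric.isOpen_iff.1 hO x hxU
    obtain ⟨r, hr0, hr⟩ : ∃ r ∈ Ioo 0 ρ, μH[(d : ℝ)] (S ∩ sphere x r) = 0 := by
      by_contra! h
      have h1 := ae_iff.1 (ae_hausdorffMeasure_inter_sphere_eq_zero hS x)
      have h2 := measure_mono_null (s := Ioo 0 ρ) (fun r hr => h r hr) h1
      rw [Real.volume_Ioo, ENNReal.ofReal_eq_zero] at h2
      linarith
    have hc : Continuous fun y : S => dist (y : X) x := by fun_prop
    refine ⟨{y : S | dist (y : X) x < r}, isOpen_lt hc continuous_const, ?_, ?_, ?_⟩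
    · simpa using hr0.1
    · exact fun y hy => hball (mem_ball.2 (lt_trans hy hr0.2))
    · have hval : IsInducing fun y : ↥(frontier {y : S | dist (y : X) x < r}) => (y.1.1 : X) :=
        IsInducing.subtypeVal.comp IsInducing.subtypeVal
      let e : ↥(frontier {y : S | dist (y : X) x < r}) → ↥(S ∩ sphere x r) :=
        fun y => ⟨y.1.1, y.1.2, frontier_lt_subset_eq hc continuous_const y.2⟩
      exact (ih hr).of_isInducing (e := e) ((IsInducing.subtypeVal.of_comp_iff (f := e)).1 hval)

end Szpilrajn

section UpperBound

universe u

/-- `S` has a finite cover by sets of diameter at most `κ` whose `h`-sum is at most `κ`. -/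
def HasSmallCover {E : Type u} [MetricSpace E] (h : ℝ≥0 → ℝ≥0) (κ : ℝ≥0) (S : Set E) : Prop :=
  ∃ (ι : Type) (_ : Fintype ι) (c : ι → Set E), S ⊆ ⋃ i, c i ∧ (∀ i, ediam (c i) ≤ κ) ∧
    ∑ i, h (ediam (c i)).toNNReal ≤ κ

lemma hMeasure_eq_zero_of_hasSmallCover {E : Type u} [MetricSpace E] {h : ℝ≥0 → ℝ≥0}
    (h0 : h 0 = 0) {S : Set E} (hS : ∀ k : ℕ, HasSmallCover h (1 / (k + 1)) S) :
    hMeasure h S = 0 := by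
  rw [hMeasure, ← nonpos_iff_eq_zero]
  refine iSup₂_le fun δ hδ => le_of_forall_gt_imp_ge_of_dense fun e he => ?_
  have hlim : Tendsto (fun k : ℕ => ((1 / ((k : ℝ≥0) + 1) : ℝ≥0) : ℝ≥0∞)) atTop (𝓝 0) := by
    exact ENNReal.tendsto_coe.2 tendsto_one_div_add_atTop_nhds_zero_nat
  obtain ⟨k, hk1, hk2⟩ := ((hlim.eventually_lt_const he).and
    (hlim.eventually_lt_const (ENNReal.coe_pos.2 hδ))).exists
  obtain ⟨ι, _, c, hc, hdiam, hsum⟩ := hS k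
  let _ := Fintype.toEncodable ι
  refine (iInf₂_le_of_le (fun i => ⋃ b ∈ Encodable.decode₂ ι i, c b)
    (by rwa [Encodable.iUnion_decode₂]) <| iInf_le_of_le (fun i => ?_) ?_)
  · exact Encodable.iUnion_decode₂_cases (C := fun s => ediam s ≤ δ) (by simp)
      fun b => (hdiam b).trans hk2.le
  · change ∑' i, ((h (ediam (⋃ b ∈ Encodable.decode₂ ι i, c b)).toNNReal : ℝ≥0) : ℝ≥0∞) ≤ e
    rw [tsum_iUnion_decode₂ (fun s => ((h (ediam s).toNNReal : ℝ≥0) : ℝ≥0∞)) (by simp [h0]),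
      tsum_fintype]
    refine le_trans ?_ hk1.le
    exact_mod_cast hsum

lemma abs_sub_mul_round_le {t a : ℝ} (ha : 0 < a) : |t - 2 * a * round (t / (2 * a))| ≤ a := by
  have h1 := abs_sub_round (t / (2 * a))
  have h2 : t - 2 * a * round (t / (2 * a)) = 2 * a * (t / (2 * a) - round (t / (2 * a))) := by
    field_simp
  rw [h2, abs_mul, abs_of_pos (by linarith : 0 < 2 * a)]
  nlinarith

lemma round_mem_Icc {t a : ℝ} (ha : 0 < a) {N : ℕ} (ht : |t| ≤ 2 * a * N) :
    round (t / (2 * a)) ∈ Finset.Icc (-(N : ℤ)) N := by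
  have h2a : 0 < 2 * a := by linarith
  have h1 : |t / (2 * a)| ≤ N := by
    rw [abs_div, abs_of_pos h2a, div_le_iff₀ h2a]; linarith
  rw [abs_le] at h1
  rw [Finset.mem_Icc, round_eq, Int.le_floor, Int.floor_le_iff]
  push_cast
  constructor <;> linarith

/-- The finite grid `2ε · {-N, …, N}ⁿ`. -/
noncomputable def cubeGrid (n N : ℕ) (ε : ℝ) : Finset (Fin n → ℝ) :=
  (Fintype.piFinset fun _ => Finset.Icc (-(N : ℤ)) N).image fun z i => 2 * ε * z i

lemma cubeGrid_pairwise {n N : ℕ} {ε : ℝ} (hε : 0 < ε) {c c' : Fin n → ℝ}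
    (hc : c ∈ cubeGrid n N ε) (hc' : c' ∈ cubeGrid n N ε) (hne : c ≠ c') :
    2 * ε ≤ dist c c' := by
  obtain ⟨z, -, rfl⟩ := Finset.mem_image.1 hc
  obtain ⟨z', -, rfl⟩ := Finset.mem_image.1 hc'
  obtain ⟨i, hi⟩ : ∃ i, z i ≠ z' i := by
    by_contra! h
    exact hne (by simp [funext h])
  refine le_trans ?_ (dist_le_pi_dist _ _ i)
  have h1 : (1 : ℝ) ≤ |(z i : ℝ) - z' i| := by
    exact_mod_cast Int.one_le_abs (sub_ne_zero.2 hi)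
  rw [Real.dist_eq, ← mul_sub, abs_mul, abs_of_pos (by linarith : 0 < 2 * ε)]
  nlinarith

lemma exists_slab {n N : ℕ} {ε η : ℝ} (hε : 0 < ε) (hη : η < ε) {y : Fin n → ℝ}
    (hy : ‖y‖ ≤ 2 * ε * N) (hyc : ∀ c ∈ cubeGrid n N ε, ε - η ≤ dist y c) :
    ∃ i, ∃ w ∈ Finset.Icc (-(N : ℤ) - 1) N, |y i - (2 * w + 1) * ε| ≤ η := by
  have hz : ∀ i, round (y i / (2 * ε)) ∈ Finset.Icc (-(N : ℤ)) N := fun i =>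
    round_mem_Icc hε ((norm_le_pi_norm y i).trans hy)
  have h1 := hyc (fun i => 2 * ε * round (y i / (2 * ε)))
    (Finset.mem_image.2 ⟨fun i => round (y i / (2 * ε)), Fintype.mem_piFinset.2 hz, rfl⟩)
  obtain ⟨i, hi⟩ : ∃ i, ε - η ≤ |y i - 2 * ε * round (y i / (2 * ε))| := by
    by_contra! h2
    exact h1.not_gt ((dist_pi_lt_iff (by linarith)).2 h2)
  have h3 := abs_sub_mul_round_le (t := y i) hε
  have h4 := Finset.mem_Icc.1 (hz i)
  generalize round (y i / (2 * ε)) = z at hi h3 h4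
  obtain ht | ht := le_total 0 (y i - 2 * ε * z)
  · refine ⟨i, z, Finset.mem_Icc.2 (by omega), ?_⟩
    rw [abs_of_nonneg ht] at hi h3
    rw [abs_le]
    constructor <;> linarith
  · refine ⟨i, z - 1, Finset.mem_Icc.2 (by omega), ?_⟩
    rw [abs_of_nonpos ht] at hi h3
    rw [abs_le]
    push_cast
    constructor <;> linarith

lemma hasSmallCover_slabs {d : ℕ} {h : ℝ≥0 → ℝ≥0} (hmono : Monotone h) {N M : ℕ} {ε R : ℝ}
    {η κ : ℝ≥0} (hη : 0 < η) (hηκ : 2 * η ≤ κ) (hM : R ≤ 2 * η * M)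
    (hsum : (d + 1) * (2 * N + 2) * (2 * M + 1) ^ d * h (2 * η) ≤ κ)
    {S : Set (Fin (d + 1) → ℝ)} (hS : ∀ y ∈ S, ‖y‖ ≤ R ∧
      ∃ i, ∃ w ∈ Finset.Icc (-(N : ℤ) - 1) N, |y i - (2 * w + 1) * ε| ≤ η) :
    HasSmallCover h κ S := by
  let c : ((Fin (d + 1) × Finset.Icc (-(N : ℤ) - 1) N) × (Fin d → Finset.Icc (-(M : ℤ)) M)) →
      Set (Fin (d + 1) → ℝ) := fun p =>
    closedBall (p.1.1.insertNth ((2 * (p.1.2 : ℤ) + 1) * ε) fun j => 2 * η * (p.2 j : ℤ)) η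
  have hdiam : ∀ p, ediam (c p) ≤ (2 * η : ℝ≥0) := fun p => by
    simp only [c, ← closedEBall_coe]
    exact ediam_closedEBall_le.trans_eq (by simp)
  refine ⟨_, inferInstance, c, fun y hy => ?_,
    fun p => (hdiam p).trans (ENNReal.coe_le_coe.2 hηκ), ?_⟩
  · obtain ⟨hyR, i, w, hw, hiw⟩ := hS y hy
    refine mem_iUnion.2 ⟨((i, ⟨w, hw⟩), fun j => ⟨round (y (i.succAbove j) / (2 * η)),
      round_mem_Icc (NNReal.coe_pos.2 hη) (((norm_le_pi_norm y _).trans hyR).trans hM)⟩), ?_⟩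
    refine (dist_pi_le_iff η.2).2 ((Fin.forall_iff_succAbove i).2 ⟨?_, fun j => ?_⟩)
    · simpa [Real.dist_eq] using hiw
    · simpa [Real.dist_eq] using abs_sub_mul_round_le (t := y (i.succAbove j))
        (NNReal.coe_pos.2 hη)
  · refine (Finset.sum_le_card_nsmul _ _ (h (2 * η)) fun p _ => hmono ?_).trans
      (le_trans (le_of_eq ?_) hsum)
    · exact ENNReal.toNNReal_mono ENNReal.coe_ne_top (hdiam p)
    · have e1 : ((N : ℤ) + 1 - (-N - 1)).toNat = 2 * N + 2 := by omega
      have e2 : ((M : ℤ) + 1 + M).toNat = 2 * M + 1 := by omega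
      simp [e1, e2]

lemma exists_hasSmallCover {d : ℕ} {h : ℝ≥0 → ℝ≥0} (hmono : Monotone h)
    (hlim : Tendsto (fun r : ℝ≥0 => (h r : ℝ) / (r : ℝ) ^ (d : ℝ)) (𝓝[>] 0) (𝓝 0))
    {N : ℕ} {ε : ℝ} (hε : 0 < ε) {κ : ℝ≥0} (hκ : 0 < κ) :
    ∃ η : ℝ, 0 < η ∧ η < ε ∧ ∀ S : Set (Fin (d + 1) → ℝ),
      (∀ y ∈ S, ‖y‖ ≤ 2 * ε * N ∧ ∀ c ∈ cubeGrid (d + 1) N ε, ε - η ≤ dist y c) →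
      HasSmallCover h κ S := by
  have hR : 0 ≤ 2 * ε * N := by positivity
  obtain ⟨C, hC⟩ : ∃ C : ℝ, C = (d + 1) * (2 * N + 2) * (2 * (2 * ε * N + 3)) ^ d := ⟨_, rfl⟩
  have hlim' := hlim.const_mul C
  rw [mul_zero] at hlim'
  have hsmall : ∀ a : ℝ≥0, 0 < a → ∀ᶠ r : ℝ≥0 in 𝓝[>] 0, r < a := fun a ha =>
    nhdsWithin_le_nhds (Iio_mem_nhds ha)
  obtain ⟨r, hr, hr0, hr2, hrκ, hrε⟩ := ((hlim'.eventually_lt_const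
    (NNReal.coe_pos.2 hκ)).and (eventually_mem_nhdsWithin.and ((hsmall 2 two_pos).and
    ((hsmall κ hκ).and (hsmall ⟨ε, hε.le⟩ hε))))).exists
  obtain ⟨η, rfl⟩ : ∃ η, r = 2 * η := ⟨r / 2, by field_simp⟩
  have hη : 0 < η := by simpa using hr0
  have hη' : (0 : ℝ) < η := hη
  have hη1 : (η : ℝ) ≤ 1 := by
    have : ((2 * η : ℝ≥0) : ℝ) < 2 := hr2
    push_cast at this; linarith
  have hηε : (η : ℝ) < ε := by
    have : ((2 * η : ℝ≥0) : ℝ) < ε := hrε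
    push_cast at this; linarith
  have hM := Nat.le_ceil (2 * ε * N / (2 * (η : ℝ)))
  have hM' := Nat.ceil_lt_add_one (show 0 ≤ 2 * ε * N / (2 * (η : ℝ)) by positivity)
  generalize ⌈2 * ε * N / (2 * (η : ℝ))⌉₊ = M at hM hM'
  have hM2 : (2 * M + 1 : ℝ) ≤ (2 * ε * N + 3) / η := by
    have h1 : 2 * (2 * ε * N / (2 * (η : ℝ))) = 2 * ε * N / η := by field_simp
    have h2 : 3 ≤ 3 / (η : ℝ) := by rw [le_div_iff₀ hη']; linarith
    rw [add_div]; linarith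
  refine ⟨η, hη', hηε, fun S hS => hasSmallCover_slabs hmono hη hrκ.le (M := M) (N := N)
    (R := 2 * ε * N) (ε := ε) ?_ ?_ fun y hy =>
      ⟨(hS y hy).1, exists_slab hε hηε (hS y hy).1 (hS y hy).2⟩⟩
  · rw [div_le_iff₀ (by linarith)] at hM
    linarith
  · rw [← NNReal.coe_le_coe]
    refine le_trans ?_ hr.le
    rw [hC, Real.rpow_natCast]
    push_cast
    have h3 := pow_le_pow_left₀ (by positivity) hM2 d
    calc ((d : ℝ) + 1) * (2 * N + 2) * (2 * M + 1) ^ d * h (2 * η)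
        ≤ (d + 1) * (2 * N + 2) * ((2 * ε * N + 3) / η) ^ d * h (2 * η) := by gcongr
      _ = _ := by rw [div_pow, mul_pow, mul_pow]; field_simp

lemma exists_radial {E : Type u} [NormedAddCommGroup E] [NormedSpace ℝ E] (F : Finset E)
    {ε δ : ℝ} (hδ : 0 < δ) (hδε : δ < ε)
    (hF : ∀ c ∈ F, ∀ c' ∈ F, c ≠ c' → 2 * ε ≤ dist c c') :
    ∃ ρ : C(E, E), (∀ x, dist (ρ x) x ≤ ε) ∧
      (∀ c ∈ F, ∀ x, dist x c ≤ δ → ρ x = c + (ε / δ) • (x - c)) ∧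
      (∀ c ∈ F, ∀ x, δ ≤ dist x c → ε ≤ dist (ρ x) c) := by
  have hε : 0 < ε := hδ.trans hδε
  have hpos : ∀ t : ℝ, 0 < max δ t := fun t => lt_max_of_lt_left hδ
  let k : E → E → E := fun c x => (max 1 (ε / max δ ‖x - c‖) - 1) • (x - c)
  have hk : ∀ c, Continuous (k c) := fun c =>
    ((continuous_const.max (continuous_const.div (by fun_prop) fun x => (hpos _).ne')).sub
      continuous_const).smul (by fun_prop)
  have hk0 : ∀ c x, ε ≤ dist x c → k c x = 0 := fun c x hx => by
    rw [dist_eq_norm] at hx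
    have : ε / max δ ‖x - c‖ ≤ 1 := (div_le_one (hpos _)).2 (le_max_of_le_right hx)
    simp [k, max_eq_left this]
  let ρ : C(E, E) := ⟨fun x => x + ∑ c ∈ F, k c x,
    continuous_id.add (continuous_finsetSum _ fun c _ => hk c)⟩
  have hρ0 : ∀ x, (∀ c ∈ F, ε ≤ dist x c) → ρ x = x := fun x hx => by
    change x + ∑ c ∈ F, k c x = x
    rw [Finset.sum_eq_zero fun c hc => hk0 c x (hx c hc), add_zero]
  have hρ1 : ∀ c ∈ F, ∀ x, dist x c < ε → ρ x = c + (ε / max δ ‖x - c‖) • (x - c) :=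
    fun c hc x hx => by
    change x + ∑ c ∈ F, k c x = _
    rw [Finset.sum_eq_single_of_mem c hc fun c' hc' hne => hk0 c' x ?_]
    · have : 1 ≤ ε / max δ ‖x - c‖ := by
        rw [dist_eq_norm] at hx
        exact (one_le_div (hpos _)).2 (max_le hδε.le hx.le)
      simp only [k, max_eq_right this, sub_smul, one_smul]
      abel
    · have := hF c hc c' hc' hne.symm
      linarith [dist_triangle_left c c' x]
  have hρ2 : ∀ c ∈ F, ∀ x, dist x c < ε → dist (ρ x) c ≤ ε := fun c hc x hx => by
    rw [hρ1 c hc x hx, dist_eq_norm, add_sub_cancel_left, norm_smul, Real.norm_of_nonneg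
      (by positivity), div_mul_eq_mul_div, div_le_iff₀ (hpos _)]
    exact mul_le_mul_of_nonneg_left (le_max_right _ _) hε.le
  refine ⟨ρ, fun x => ?_, fun c hc x hx => ?_, fun c hc x hx => ?_⟩
  · by_cases hx : ∀ c ∈ F, ε ≤ dist x c
    · rw [hρ0 x hx, dist_self]; exact hε.le
    · push Not at hx
      obtain ⟨c, hc, hxc⟩ := hx
      have h1 : ρ x - x = (ε / max δ ‖x - c‖ - 1) • (x - c) := by
        rw [hρ1 c hc x hxc, sub_smul, one_smul]; abel
      rw [dist_eq_norm] at hxc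
      have h2 : 1 ≤ ε / max δ ‖x - c‖ := (one_le_div (hpos _)).2 (max_le hδε.le hxc.le)
      have h3 : ε / max δ ‖x - c‖ * ‖x - c‖ ≤ ε := by
        rw [div_mul_eq_mul_div, div_le_iff₀ (hpos _)]
        exact mul_le_mul_of_nonneg_left (le_max_right _ _) hε.le
      rw [dist_eq_norm, h1, norm_smul, Real.norm_of_nonneg (by linarith)]
      nlinarith [norm_nonneg (x - c)]
  · rw [hρ1 c hc x (hx.trans_lt hδε), max_eq_left (by rwa [← dist_eq_norm])]
  · by_cases hx' : ∀ c ∈ F, ε ≤ dist x c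
    · rw [hρ0 x hx']; exact hx' c hc
    · push Not at hx'
      obtain ⟨c', hc', hxc'⟩ := hx'
      by_cases hcc : c = c'
      · subst hcc
        rw [dist_eq_norm] at hx
        rw [hρ1 c hc x hxc', dist_eq_norm, add_sub_cancel_left, norm_smul, Real.norm_of_nonneg
          (by positivity), max_eq_right hx, div_mul_cancel₀ _ (by linarith)]
      · have h1 := hF c hc c' hc' hcc
        linarith [hρ2 c' hc' x hxc', dist_triangle_left c c' (ρ x)]

lemma exists_stable_or_missed {X : Type u} [TopologicalSpace X] [CompactSpace X] {n : ℕ}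
    (F : Finset (Fin n → ℝ)) (f₀ : C(X, Fin n → ℝ)) {ε : ℝ} (hε : 0 < ε) :
    ∃ f, dist f f₀ < ε ∧ ∃ δ > 0, δ < ε ∧
      ∀ c ∈ F, StableValue f δ c ∨ ∀ x, δ ≤ dist (f x) c := by
  have hres : ∀ c ∈ F, ∀ᶠ f in residual C(X, Fin n → ℝ),
      ∀ᶠ δ in 𝓝[>] (0 : ℝ), StableValue f δ c ∨ ∀ x, δ ≤ dist (f x) c := by
    intro c _
    obtain ⟨V, hV⟩ : ∃ V : Set C(X, Fin n → ℝ), V = {f | ∃ δ > 0, ∀ x, δ ≤ dist (f x) c} :=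
      ⟨_, rfl⟩
    have hVo : IsOpen V := by
      rw [Metric.isOpen_iff, hV]
      rintro f ⟨δ, hδ, hf⟩
      refine ⟨δ / 2, by linarith, fun g hg => ⟨δ / 2, by linarith, fun x => ?_⟩⟩
      have h1 := ContinuousMap.dist_apply_le_dist (f := g) (g := f) x
      have h2 := dist_triangle_left (f x) c (g x)
      linarith [hf x, mem_ball.1 hg]
    have hVd : Dense (V ∪ (closure V)ᶜ) := by
      intro f
      by_cases hf : f ∈ closure V
      · exact closure_mono subset_union_left hf
      · exact subset_closure (Or.inr hf)
    filter_upwards [residual_of_dense_open (hVo.union isClosed_closure.isOpen_compl) hVd]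
      with f hf
    obtain hf | hf := hf
    · rw [hV] at hf
      obtain ⟨δ, hδ, hf⟩ := hf
      filter_upwards [Ioo_mem_nhdsGT hδ] with δ' hδ'
      exact Or.inr fun x => hδ'.2.le.trans (hf x)
    · obtain ⟨δ, hδ, hball⟩ := Metric.isOpen_iff.1 isClosed_closure.isOpen_compl f hf
      filter_upwards [Ioo_mem_nhdsGT hδ] with δ' hδ'
      refine Or.inl fun g hg => by_contra fun hgc => ?_
      refine hball (mem_ball.2 (hg.trans_lt hδ'.2)) (subset_closure ?_)
      rw [hV]
      have hcl : IsClosed (range g) := (isCompact_range g.continuous).isClosed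
      obtain ⟨s, hs, hsub⟩ := Metric.isOpen_iff.1 hcl.isOpen_compl c hgc
      exact ⟨s, hs, fun x => le_of_not_gt fun hx => hsub (mem_ball.2 hx) (mem_range_self x)⟩
  have hall := (Filter.eventually_all_finset F).2 hres
  obtain ⟨f, hf, hfr⟩ := (dense_of_mem_residual hall).exists_dist_lt f₀ hε
  refine ⟨f, by rwa [dist_comm], ?_⟩
  obtain ⟨δ, hδ, hδ'⟩ := (((Filter.eventually_all_finset F).2 hf).and
    (Ioo_mem_nhdsGT hε)).exists
  exact ⟨δ, hδ'.1, hδ'.2, hδ⟩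

lemma frontier_range_disjoint_ball {X : Type u} [TopologicalSpace X] [CompactSpace X] {n : ℕ}
    {f : C(X, Fin n → ℝ)} {ρ : C(Fin n → ℝ, Fin n → ℝ)} {c : Fin n → ℝ} {ε δ η : ℝ}
    (hδ : 0 < δ) (hδε : δ < ε)
    (hρ : ∀ x, dist x c ≤ δ → ρ x = c + (ε / δ) • (x - c))
    (hρ' : ∀ x, δ ≤ dist x c → ε ≤ dist (ρ x) c)
    (hf : StableValue f δ c ∨ ∀ x, δ ≤ dist (f x) c)
    {g : C(X, Fin n → ℝ)} (hg : dist g (ρ.comp f) ≤ η) {y : Fin n → ℝ}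
    (hy : y ∈ frontier (range g)) : ε - η ≤ dist y c := by
  by_contra! hlt
  have hε : 0 < ε := hδ.trans hδε
  have hsub : ball c (ε - η) ⊆ range g ∨ Disjoint (ball c (ε - η)) (range g) := by
    have hgx := fun x => (ContinuousMap.dist_apply_le_dist (f := g) (g := ρ.comp f) x).trans hg
    obtain hf | hf := hf
    · refine Or.inl fun z hz => ?_
      rw [mem_ball, dist_comm, dist_eq_norm] at hz
      have hnorm : ∀ x, ‖(δ / ε) • (g x - ρ (f x) + (c - z))‖ < δ := fun x => by
        have h1 := hgx x
        rw [dist_eq_norm] at h1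
        rw [norm_smul, Real.norm_of_nonneg (by positivity), div_mul_eq_mul_div, div_lt_iff₀ hε]
        refine mul_lt_mul_of_pos_left ((norm_add_le _ _).trans_lt ?_) hδ
        exact lt_of_le_of_lt (add_le_add_left h1 _) (by linarith)
      obtain ⟨x, hx⟩ := hf (f + (δ / ε) • (g - ρ.comp f + ContinuousMap.const X (c - z))) (by
        rw [ContinuousMap.dist_le hδ.le]
        intro x
        rw [dist_eq_norm]
        simpa using (hnorm x).le)
      replace hx : f x + (δ / ε) • (g x - ρ (f x) + (c - z)) = c := hx
      have hfx : dist (f x) c ≤ δ := by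
        rw [dist_eq_norm, ← norm_neg, neg_sub]
        nth_rewrite 1 [← hx]
        rw [add_sub_cancel_left]
        exact (hnorm x).le
      rw [hρ _ hfx] at hx
      refine ⟨x, ?_⟩
      have h2 : (δ / ε) • (g x - z) = 0 := by
        have h3 : (δ / ε) • (ε / δ) • (f x - c) = f x - c := by
          rw [smul_smul, div_mul_div_cancel₀ hε.ne', div_self hδ.ne', one_smul]
        have h4 : g x - (c + (ε / δ) • (f x - c)) + (c - z) = (g x - z) - (ε / δ) • (f x - c) := by
          abel
        rw [h4, smul_sub, h3] at hx
        rw [← sub_eq_zero] at hx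
        rw [← hx]; abel
      exact sub_eq_zero.1 ((smul_eq_zero.1 h2).resolve_left (by positivity))
    · refine Or.inr (disjoint_right.2 ?_)
      rintro _ ⟨x, rfl⟩ hx
      have h1 := hρ' _ (hf x)
      have h2 := hgx x
      have h3 := dist_triangle_left (ρ (f x)) c (g x)
      rw [ContinuousMap.comp_apply] at h2
      linarith [mem_ball.1 hx]
  obtain hsub | hsub := hsub
  · exact hy.2 (interior_maximal hsub isOpen_ball (mem_ball.2 hlt))
  · exact (hsub.closure_right isOpen_ball).le_bot ⟨mem_ball.2 hlt, hy.1⟩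

theorem eventually_residual_hMeasure_frontier_eq_zero {X : Type u} [MetricSpace X]
    [CompactSpace X] {d : ℕ} {h : ℝ≥0 → ℝ≥0} (hmono : Monotone h)
    (hlim : Tendsto (fun r : ℝ≥0 => (h r : ℝ) / (r : ℝ) ^ (d : ℝ)) (𝓝[>] 0) (𝓝 0)) :
    ∀ᶠ f : C(X, Fin (d + 1) → ℝ) in residual C(X, Fin (d + 1) → ℝ),
      hMeasure h (frontier (range f)) = 0 := by
  have h0 : h 0 = 0 := by
    have h1 : Tendsto (fun r : ℝ≥0 => (h r : ℝ)) (𝓝[>] 0) (𝓝 0) := by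
      refine squeeze_zero' (.of_forall fun r => (h r).2) ?_ hlim
      filter_upwards [Ioo_mem_nhdsGT (zero_lt_one' ℝ≥0)] with r hr
      have hr0 : (0 : ℝ) < r := hr.1
      exact le_div_self (h r).2 (Real.rpow_pos_of_pos hr0 _)
        (Real.rpow_le_one hr0.le (by exact_mod_cast hr.2.le) (Nat.cast_nonneg d))
    have h2 : (h 0 : ℝ) ≤ 0 := ge_of_tendsto h1 (.of_forall fun r => hmono zero_le)
    exact_mod_cast le_antisymm h2 (h 0).2
  suffices H : ∀ κ : ℝ≥0, 0 < κ → ∀ᶠ f : C(X, Fin (d + 1) → ℝ) in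
      residual C(X, Fin (d + 1) → ℝ), HasSmallCover h κ (frontier (range f)) by
    filter_upwards [eventually_countable_forall.2 fun k : ℕ => H (1 / (k + 1)) (by positivity)]
      with f hf
    exact hMeasure_eq_zero_of_hasSmallCover h0 hf
  intro κ hκ
  refine mem_of_superset (residual_of_dense_open isOpen_interior ?_) interior_subset
  rw [Metric.dense_iff]
  intro f₀ r hr
  obtain ⟨ε, hε, hεr, hε1⟩ : ∃ ε : ℝ, 0 < ε ∧ 2 * ε < r ∧ ε ≤ 1 :=
    ⟨min (r / 3) 1, by positivity, by linarith [min_le_left (r / 3) 1], min_le_right _ _⟩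
  obtain ⟨N, hN⟩ := exists_nat_ge ((‖f₀‖ + 3) / (2 * ε))
  rw [div_le_iff₀ (by linarith)] at hN
  obtain ⟨η, hη, hηε, hcov⟩ := exists_hasSmallCover hmono hlim (N := N) hε hκ
  obtain ⟨f, hf, δ, hδ, hδε, hfc⟩ := exists_stable_or_missed (cubeGrid (d + 1) N ε) f₀ hε
  obtain ⟨ρ, hρ, hρ1, hρ2⟩ := exists_radial (cubeGrid (d + 1) N ε) hδ hδε
    fun c hc c' hc' => cubeGrid_pairwise hε hc hc'
  have hfρ : dist (ρ.comp f) f ≤ ε := (ContinuousMap.dist_le hε.le).2 fun x => hρ _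
  have hρf : dist (ρ.comp f) f₀ < 2 * ε := by linarith [dist_triangle (ρ.comp f) f f₀]
  refine ⟨ρ.comp f, mem_ball.2 (by linarith), mem_interior.2
    ⟨ball (ρ.comp f) η, fun g hg => hcov _ fun y hy => ⟨?_, fun c hc => ?_⟩, isOpen_ball,
      mem_ball_self hη⟩⟩
  · obtain ⟨x, rfl⟩ := (isCompact_range g.continuous).isClosed.frontier_subset hy
    have h1 := g.norm_coe_le_norm x
    have h2 : ‖g‖ ≤ dist g f₀ + ‖f₀‖ := by
      rw [dist_eq_norm]; simpa using norm_add_le (g - f₀) f₀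
    have h3 := dist_triangle g (ρ.comp f) f₀
    have := mem_ball.1 hg
    linarith
  · exact frontier_range_disjoint_ball hδ hδε (hρ1 c hc) (hρ2 c hc) (hfc c hc)
      (mem_ball.1 hg).le hy

end UpperBound

section Assembly

open MeasureTheory MeasureTheory.Measure

universe u

lemma hausdorffMeasure_eq_zero_of_hMeasure {E : Type u} [MetricSpace E] [MeasurableSpace E]
    [BorelSpace E] {s : ℝ} (hs : 0 ≤ s) {S : Set E}
    (hS : hMeasure (fun r => r ^ s) S = 0) : μH[s] S = 0 := by
  rw [hausdorffMeasure_apply, ← nonpos_iff_eq_zero]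
  refine iSup₂_le fun r hr => le_of_forall_gt_imp_ge_of_dense fun e he => ?_
  obtain ⟨δ, hδ, hδr⟩ := ENNReal.lt_iff_exists_nnreal_btwn.1 hr
  have hδ0 : 0 < δ := ENNReal.coe_pos.1 hδ
  simp only [hMeasure, ENNReal.iSup_eq_zero] at hS
  have h1 := (hS δ hδ0).trans_lt he
  simp only [iInf_lt_iff] at h1
  obtain ⟨c, hc, hdiam, hsum⟩ := h1
  refine iInf₂_le_of_le c hc (iInf_le_of_le (fun i => (hdiam i).trans hδr.le) ?_)
  refine (ENNReal.tsum_le_tsum fun i => iSup_le fun _ => ?_).trans hsum.le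
  have hfin : ediam (c i) ≠ ∞ := ((hdiam i).trans_lt ENNReal.coe_lt_top).ne
  rw [ENNReal.coe_rpow_of_nonneg _ hs]
  exact (congrArg (· ^ s) (ENNReal.coe_toNNReal hfin)).ge

lemma EReal.natCast_sub_one (n : ℕ) : (n : EReal) - 1 = ((n - 1 : ℝ) : EReal) := by
  rw [EReal.coe_sub, EReal.coe_natCast, EReal.coe_one]

lemma not_indBelow_of_le_tdim {X : Type u} [MetricSpace X] {n : ℕ}
    (h : (n : EReal) ≤ tdim (univ : Set X)) : ¬ indBelow n X := fun hX => by
  have h1 : indBelow n (univ : Set X) := hX.of_isInducing (Homeomorph.Set.univ X).isInducing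
  have h2 : tdim (univ : Set X) ≤ (n : EReal) - 1 := sInf_le ⟨n, h1, rfl⟩
  have h3 := h.trans h2
  rw [EReal.natCast_sub_one, ← EReal.coe_natCast, EReal.coe_le_coe_iff] at h3
  linarith

lemma tdim_eq {X : Type u} [MetricSpace X] {A : Set X} {d : ℕ} (h : ¬ indBelow d A)
    (h' : indBelow (d + 1) A) : tdim A = d := by
  refine le_antisymm (sInf_le ⟨d + 1, h', ?_⟩) (le_sInf ?_)
  · rw [EReal.natCast_sub_one, Nat.cast_add_one, add_sub_cancel_right, EReal.coe_natCast]
  · rintro _ ⟨m, hm, rfl⟩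
    have hdm : d + 1 ≤ m := by
      by_contra! hlt
      exact h (hm.mono (by omega))
    have : ((d + 1 : ℕ) : ℝ) ≤ m := by exact_mod_cast hdm
    rw [EReal.natCast_sub_one, ← EReal.coe_natCast, EReal.coe_le_coe_iff]
    push_cast at this
    linarith

lemma tendsto_rpow_add_div_rpow {s t : ℝ} (ht : 0 < t) :
    Tendsto (fun r : ℝ≥0 => ((r ^ (s + t) : ℝ≥0) : ℝ) / (r : ℝ) ^ s) (𝓝[>] 0) (𝓝 0) := by
  have h1 : Tendsto (fun r : ℝ≥0 => (r : ℝ) ^ t) (𝓝[>] 0) (𝓝 0) := by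
    have h2 : Continuous fun r : ℝ≥0 => (r : ℝ) ^ t :=
      NNReal.continuous_coe.rpow_const fun _ => Or.inr ht.le
    have h3 := h2.tendsto 0
    rw [NNReal.coe_zero, Real.zero_rpow ht.ne'] at h3
    exact h3.mono_left nhdsWithin_le_nhds
  refine h1.congr' ?_
  filter_upwards [self_mem_nhdsWithin] with r hr
  have hr0 : (0 : ℝ) < r := hr
  rw [NNReal.coe_rpow, Real.rpow_add hr0]
  field_simp

theorem eventually_residual_dimH_frontier_le {X : Type u} [MetricSpace X] [CompactSpace X]
    {d : ℕ} : ∀ᶠ f : C(X, Fin (d + 1) → ℝ) in residual C(X, Fin (d + 1) → ℝ),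
      dimH (frontier (range f)) ≤ d := by
  have h1 : ∀ k : ℕ, ∀ᶠ f : C(X, Fin (d + 1) → ℝ) in residual C(X, Fin (d + 1) → ℝ),
      hMeasure (fun r => r ^ ((d : ℝ) + 1 / ((k : ℝ) + 1))) (frontier (range f)) = 0 := fun k =>
    eventually_residual_hMeasure_frontier_eq_zero
      (fun a b hab => NNReal.rpow_le_rpow hab (by positivity))
      (tendsto_rpow_add_div_rpow (by positivity))
  filter_upwards [eventually_countable_forall.2 h1] with f hf
  have h2 : ∀ k : ℕ, dimH (frontier (range f)) ≤
      (((d : ℝ≥0) + 1 / ((k : ℝ≥0) + 1) : ℝ≥0) : ℝ≥0∞) := fun k => by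
    refine dimH_le_of_hausdorffMeasure_ne_top ?_
    have := hausdorffMeasure_eq_zero_of_hMeasure (by positivity) (hf k)
    push_cast
    rw [this]
    exact ENNReal.zero_ne_top
  have h3 : Tendsto (fun k : ℕ => (((d : ℝ≥0) + 1 / ((k : ℝ≥0) + 1) : ℝ≥0) : ℝ≥0∞)) atTop
      (𝓝 ((d + 0 : ℝ≥0) : ℝ≥0∞)) :=
    ENNReal.tendsto_coe.2 (tendsto_one_div_add_atTop_nhds_zero_nat.const_add _)
  simpa using ge_of_tendsto' h3 h2

theorem eventually_residual_not_indBelow_frontier {X : Type u} [MetricSpace X] [CompactSpace X]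
    {d : ℕ} (hX : ¬ indBelow (d + 1) X) :
    ∀ᶠ f : C(X, Fin (d + 1) → ℝ) in residual C(X, Fin (d + 1) → ℝ),
      ¬ indBelow d (frontier (range f)) := by
  filter_upwards [eventually_residual_interior_nonempty hX] with f hf
  exact not_indBelow_frontier (isCompact_range f.continuous) hf

lemma hdim_eq {X : Type u} [MetricSpace X] {A : Set X} {d : ℕ} (h : ¬ indBelow d A)
    (h' : dimH A ≤ d) : hdim A = d := by
  borelize X
  have hne : A ≠ ∅ := by
    rintro rfl
    exact h (indBelow_of_isEmpty d _)
  have h1 : dimH A = d := le_antisymm h' <| by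
    have := le_dimH_of_hausdorffMeasure_ne_zero (s := A) (d := (d : ℝ≥0)) (by
      exact_mod_cast mt indBelow_of_hausdorffMeasure_eq_zero h)
    exact_mod_cast this
  rw [hdim, if_neg hne, h1]
  rfl

end Assembly

/-- Dimensions of the boundary of a generic image. -/
theorem stmt12 (n : ℕ) (hn : 0 < n) (K : Type*) [MetricSpace K] [CompactSpace K]
    (hK : (n : EReal) ≤ tdim (Set.univ : Set K)) :
    (∀ᶠ (f : C(K, Fin n → ℝ)) in residual C(K, Fin n → ℝ),
      tdim (frontier (Set.range ⇑f)) = (n : EReal) - 1 ∧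
      hdim (frontier (Set.range ⇑f)) = (n : EReal) - 1) ∧
    ∀ h : ℝ≥0 → ℝ≥0, Monotone h →
      Filter.Tendsto (fun r : ℝ≥0 => (h r : ℝ) / (r : ℝ) ^ ((n : ℝ) - 1))
        (nhdsWithin 0 (Set.Ioi 0)) (nhds 0) →
      ∀ᶠ (f : C(K, Fin n → ℝ)) in residual C(K, Fin n → ℝ),
        hMeasure h (frontier (Set.range ⇑f)) = 0 ∧
        0 < hMeasure (fun r => r ^ ((n : ℝ) - 1)) (frontier (Set.range ⇑f)) := by
  obtain ⟨d, rfl⟩ : ∃ d, n = d + 1 := ⟨n - 1, by omega⟩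
  have hd : ((d + 1 : ℕ) : ℝ) - 1 = d := by push_cast; ring
  have hdE : ((d + 1 : ℕ) : EReal) - 1 = d := by
    rw [EReal.natCast_sub_one, hd, EReal.coe_natCast]
  have hind := eventually_residual_not_indBelow_frontier (not_indBelow_of_le_tdim hK)
  rw [hd, hdE]
  refine ⟨?_, fun h hmono hlim => ?_⟩
  · filter_upwards [hind, eventually_residual_dimH_frontier_le] with f hf hdim
    refine ⟨tdim_eq hf (indBelow_of_hausdorffMeasure_eq_zero ?_), hdim_eq hf hdim⟩
    have hlt : dimH (frontier (range f)) < ((d + 1 : ℝ≥0) : ℝ≥0∞) :=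
      hdim.trans_lt (by exact_mod_cast Nat.lt_succ_self d)
    simpa using hausdorffMeasure_of_dimH_lt hlt
  · filter_upwards [hind, eventually_residual_hMeasure_frontier_eq_zero hmono hlim]
      with f hf hzero
    refine ⟨hzero, pos_iff_ne_zero.2 fun h0 => hf (indBelow_of_hausdorffMeasure_eq_zero ?_)⟩
    exact hausdorffMeasure_eq_zero_of_hMeasure (Nat.cast_nonneg d) h0
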